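/- arXiv:2304.00816 — 3 statements merged into one kernel-verified Lean document; each statement's English description precedes it below -/
import Mathlib

section
/- The 2-adic Hurwitz zeta value ζ₂(3,1/4) is irrational, i.e. does not lie in the image of ℚ in ℚ₂. -/
open Filter Finset

/-- `zeta2Quarter j z` says that `z` is the 2-adic Hurwitz zeta value `ζ₂(j, 1/4)`,
i.e. `(j-1) * 4^(j-1) * z` is the 2-adic limit of the Volkenborn sums
`2^{-M} ∑_{k=0}^{2^M-1} (k+1/4)^{1-j}`. -/
def zeta2Quarter (j : ℕ) (z : ℚ_[2]) : Prop :=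
  Filter.Tendsto
    (fun M : ℕ => (2 ^ M : ℚ_[2])⁻¹ *
      ∑ k ∈ Finset.range (2 ^ M), ((((k : ℚ) + 1/4) ^ ((1 : ℤ) - (j : ℤ)) : ℚ) : ℚ_[2]))
    Filter.atTop (nhds (((j : ℚ_[2]) - 1) * 4 ^ (j - 1) * z))


def dn (n : ℕ) : ℕ := (Finset.Icc 1 n).lcm id

lemma dn_dvd {a n : ℕ} (h1 : 1 ≤ a) (h2 : a ≤ n) : a ∣ dn n :=
  Finset.dvd_lcm (f := id) (Finset.mem_Icc.2 ⟨h1, h2⟩)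

lemma dn_dvd_of {n X : ℕ} (h : ∀ a, 1 ≤ a → a ≤ n → a ∣ X) : dn n ∣ X :=
  Finset.lcm_dvd fun a ha => h a (Finset.mem_Icc.1 ha).1 (Finset.mem_Icc.1 ha).2

lemma dn_dvd_dn {m n : ℕ} (h : m ≤ n) : dn m ∣ dn n :=
  dn_dvd_of fun _ h1 h2 => dn_dvd h1 (h2.trans h)

lemma dn_pos (n : ℕ) : 0 < dn n := by
  have : dn n ∣ n.factorial := dn_dvd_of fun a h1 h2 => Nat.dvd_factorial h1 h2
  exact Nat.pos_of_dvd_of_pos this (Nat.factorial_pos n)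

lemma dn_le_factorial (n : ℕ) : dn n ≤ n.factorial :=
  Nat.le_of_dvd (Nat.factorial_pos n) (dn_dvd_of fun _ h1 h2 => Nat.dvd_factorial h1 h2)

lemma floor_aux (m q : ℕ) (hq : 0 < q) :
    3 * m / q + 2 * m / q + m / q + (if m < q ∧ q ≤ 6 * m then 1 else 0) ≤ 6 * m / q := by
  have h3 := Nat.div_mul_le_self (3 * m) q
  have h2 := Nat.div_mul_le_self (2 * m) q
  have h1 := Nat.div_mul_le_self m q
  rw [Nat.le_div_iff_mul_le hq]
  split_ifs with h
  · obtain ⟨ha, hb⟩ := h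
    rw [Nat.div_eq_of_lt ha]
    have e3 : 3 * m / q ≤ 2 := by
      have : 3 * m / q < 3 := by rw [Nat.div_lt_iff_lt_mul hq]; omega
      omega
    have e2 : 2 * m / q ≤ 1 := by
      have : 2 * m / q < 2 := by rw [Nat.div_lt_iff_lt_mul hq]; omega
      omega
    generalize 3 * m / q = a at *
    generalize 2 * m / q = b at *
    interval_cases a <;> interval_cases b <;> omega
  · nlinarith

lemma dn_six (m : ℕ) : dn (6 * m) ∣ dn m * ((6 * m).choose (3 * m) * (3 * m).choose m) := by
  rcases Nat.eq_zero_or_pos m with rfl | hm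
  · simp [dn]
  apply dn_dvd_of
  intro a ha1 ha2
  rw [Nat.dvd_iff_prime_pow_dvd_dvd]
  intro p e hp hpe
  have hpe' : p ^ e ≤ 6 * m := (Nat.le_of_dvd (by omega) hpe).trans ha2
  set N := (6 * m).choose (3 * m) * (3 * m).choose m with hN
  have hfac : N * ((3 * m).factorial * ((2 * m).factorial * m.factorial)) = (6 * m).factorial := by
    have e1 := Nat.choose_mul_factorial_mul_factorial (show 3 * m ≤ 6 * m by omega)
    have e2 := Nat.choose_mul_factorial_mul_factorial (show m ≤ 3 * m by omega)
    rw [show 6 * m - 3 * m = 3 * m by omega] at e1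
    rw [show 3 * m - m = 2 * m by omega] at e2
    rw [← e1, hN]
    calc _ = (6 * m).choose (3 * m) * (3 * m).factorial *
          ((3 * m).choose m * m.factorial * (2 * m).factorial) := by ring
      _ = _ := by rw [e2]
  have hN0 : N ≠ 0 := by
    intro h
    rw [h, zero_mul] at hfac
    exact (Nat.factorial_pos _).ne hfac
  have := Fact.mk hp
  have hv := congrArg (padicValNat p) hfac
  have f3 := (Nat.factorial_pos (3 * m)).ne'
  have f2 := (Nat.factorial_pos (2 * m)).ne'
  have f1 := (Nat.factorial_pos m).ne'
  rw [padicValNat.mul hN0 (by positivity), padicValNat.mul f3 (by positivity),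
    padicValNat.mul f2 f1] at hv
  set b := Nat.log p (6 * m) + 1 with hb
  have lt : ∀ c, c ≤ 6 * m → Nat.log p c < b := fun c hc =>
    Nat.lt_succ_of_le (Nat.log_mono_right hc)
  rw [padicValNat_factorial (lt (3*m) (by omega)), padicValNat_factorial (lt (2*m) (by omega)),
    padicValNat_factorial (lt m (by omega)), padicValNat_factorial (lt (6*m) le_rfl)] at hv
  have key : ∑ i ∈ Finset.Ico 1 b, (if m < p ^ i ∧ p ^ i ≤ 6 * m then 1 else 0) ≤ padicValNat p N := by
    have hs := Finset.sum_le_sum (s := Finset.Ico 1 b) fun i _ => floor_aux m (p ^ i) (pow_pos hp.pos i)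
    simp only [Finset.sum_add_distrib] at hs
    omega
  have hcard : e - Nat.log p m ≤ padicValNat p N := by
    refine le_trans ?_ key
    rw [← Finset.sum_filter, Finset.sum_const, smul_eq_mul, mul_one]
    calc e - Nat.log p m = (Finset.Ioc (Nat.log p m) e).card := by simp
      _ ≤ _ := by
        apply Finset.card_le_card
        intro i hi
        rw [Finset.mem_Ioc] at hi
        have hpi : p ^ i ≤ 6 * m := (Nat.pow_le_pow_right hp.pos hi.2).trans hpe'
        simp only [Finset.mem_filter, Finset.mem_Ico]
        refine ⟨⟨by omega, ?_⟩, Nat.lt_pow_of_log_lt hp.one_lt hi.1, hpi⟩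
        have := Nat.le_log_of_pow_le hp.one_lt hpi
        omega
  have hdvd1 : p ^ Nat.log p m ∣ dn m :=
    dn_dvd (Nat.pow_pos hp.pos) (Nat.pow_log_le_self p hm.ne')
  have hdvd2 : p ^ (e - Nat.log p m) ∣ N := (padicValNat_dvd_iff_le hN0).2 hcard
  have := mul_dvd_mul hdvd1 hdvd2
  rw [← pow_add] at this
  exact (pow_dvd_pow p (by omega)).trans this

lemma mult_le (m : ℕ) : (6 * m).choose (3 * m) * (3 * m).choose m ≤ 432 ^ m := by
  have h1 : (6 * m).choose (3 * m) ≤ 64 ^ m := by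
    calc _ ≤ 2 ^ (6 * m) := Nat.choose_le_two_pow _ _
      _ = 64 ^ m := by rw [pow_mul]; norm_num
  have h2 : (3 * m).choose m * 4 ^ m ≤ 27 ^ m := by
    have := add_pow 1 2 (3 * m)
    have h := Finset.single_le_sum (f := fun k => 1 ^ k * 2 ^ (3 * m - k) * (3 * m).choose k)
      (s := Finset.range (3 * m + 1)) (fun _ _ => Nat.zero_le _)
      (Finset.mem_range.2 (show m < 3 * m + 1 by omega))
    push_cast at this
    rw [← this, one_pow, one_mul, show 3 * m - m = 2 * m by omega, pow_mul, pow_mul] at h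
    norm_num at h
    linarith
  have h3 : (432 : ℕ) ^ m * 4 ^ m = 64 ^ m * 27 ^ m := by
    rw [← mul_pow, ← mul_pow]; norm_num
  have h4 : 0 < 4 ^ m := by positivity
  refine Nat.le_of_mul_le_mul_right ?_ h4
  rw [h3, mul_assoc]
  exact Nat.mul_le_mul h1 h2

lemma dn_le : ∃ C : ℝ, 0 < C ∧ ∀ n, (dn n : ℝ) ≤ C * (39 / 10 : ℝ) ^ n := by
  refine ⟨(Nat.factorial 100 : ℕ), by positivity, ?_⟩
  intro n
  induction n using Nat.strong_induction_on with
  | _ n ih =>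
    by_cases hn : n < 100
    · have h1 : (dn n : ℝ) ≤ (Nat.factorial 100 : ℕ) := by
        exact_mod_cast (dn_le_factorial n).trans (Nat.factorial_le hn.le)
      have h2 : (1 : ℝ) ≤ (39 / 10 : ℝ) ^ n := one_le_pow₀ (by norm_num)
      have h3 : (0 : ℝ) < (Nat.factorial 100 : ℕ) := by positivity
      exact h1.trans (le_mul_of_one_le_right h3.le h2)
    · push Not at hn
      set m := n / 6 with hm
      have hle : dn n ≤ dn (m + 1) * 432 ^ (m + 1) := by
        have h1 : dn n ≤ dn (6 * (m + 1)) := Nat.le_of_dvd (dn_pos _) (dn_dvd_dn (by omega))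
        have h2 := Nat.le_of_dvd (Nat.mul_pos (dn_pos _) (Nat.mul_pos (Nat.choose_pos (by omega))
          (Nat.choose_pos (by omega)))) (dn_six (m + 1))
        exact h1.trans (h2.trans (Nat.mul_le_mul_left _ (mult_le _)))
      have hle' : (dn n : ℝ) ≤ dn (m + 1) * 432 ^ (m + 1) := by exact_mod_cast hle
      have ihm := ih (m + 1) (by omega)
      have hC : (0 : ℝ) < (Nat.factorial 100 : ℕ) := by positivity
      generalize ((Nat.factorial 100 : ℕ) : ℝ) = C at *
      have key : (39 / 10 : ℝ) ^ (m + 1) * 432 ^ (m + 1) ≤ (39 / 10 : ℝ) ^ n := by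
        have a1 : (39 / 10 : ℝ) ^ (6 * m) ≤ (39 / 10 : ℝ) ^ n :=
          pow_le_pow_right₀ (by norm_num) (by omega)
        refine le_trans ?_ a1
        have hm16 : 16 ≤ m := by omega
        obtain ⟨r, hr⟩ := Nat.exists_eq_add_of_le hm16
        rw [hr, ← mul_pow, pow_mul, show 16 + r + 1 = r + 17 by ring, add_comm 16 r, pow_add,
          pow_add]
        have b1 : ((39 / 10 : ℝ) * 432) ^ r ≤ ((39 / 10 : ℝ) ^ 6) ^ r :=
          pow_le_pow_left₀ (by norm_num) (by norm_num) r
        have b2 : ((39 / 10 : ℝ) * 432) ^ 17 ≤ ((39 / 10 : ℝ) ^ 6) ^ 16 := by norm_num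
        exact mul_le_mul b1 b2 (by positivity) (by positivity)
      calc (dn n : ℝ) ≤ dn (m + 1) * 432 ^ (m + 1) := hle'
        _ ≤ (C * (39 / 10 : ℝ) ^ (m + 1)) * 432 ^ (m + 1) := by gcongr
        _ = C * ((39 / 10 : ℝ) ^ (m + 1) * 432 ^ (m + 1)) := by ring
        _ ≤ _ := by gcongr

lemma leibniz (u : ℕ) : ∀ v : ℕ, (u + v + 1).factorial ∣ dn (u + v + 1) * (u.factorial * v.factorial) := by
  induction u with
  | zero =>
    intro v
    have : v + 1 ∣ dn (v + 1) := dn_dvd (by omega) le_rfl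
    simp only [zero_add, Nat.factorial_zero, one_mul, Nat.factorial_succ]
    exact mul_dvd_mul this dvd_rfl
  | succ u ih =>
    intro v
    have h1 := ih v
    have h2 := ih (v + 1)
    rw [show u + 1 + v + 1 = u + v + 1 + 1 by ring]
    rw [show u + (v + 1) + 1 = u + v + 1 + 1 by ring] at h2
    have h1' : (u + v + 1 + 1).factorial ∣
        dn (u + v + 1 + 1) * ((u + v + 1 + 1) * (u.factorial * v.factorial)) := by
      rw [Nat.factorial_succ]
      have := mul_dvd_mul (dvd_refl (u + v + 1 + 1)) (h1.trans (Nat.mul_dvd_mul_right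
        (dn_dvd_dn (show u + v + 1 ≤ u + v + 1 + 1 by omega)) (u.factorial * v.factorial)))
      rwa [mul_left_comm] at this
    rw [show dn (u + v + 1 + 1) * ((u + v + 1 + 1) * (u.factorial * v.factorial)) =
      dn (u + v + 1 + 1) * (u.factorial * (v + 1).factorial) +
      dn (u + v + 1 + 1) * ((u + 1).factorial * v.factorial) by
        rw [Nat.factorial_succ, Nat.factorial_succ]; ring] at h1'
    exact (Nat.dvd_add_right h2).1 h1'

def rho (n k : ℕ) : ℚ :=
  2 ^ n * (-1) ^ k / (k.factorial * (n - k).factorial) * ∏ i ∈ range n, (4 * ((i : ℚ) + 1 - k) - 1)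

lemma prod_rev_fact (k : ℕ) : ∏ i ∈ range k, ((k : ℚ) - i) = k.factorial := by
  rw [← Finset.prod_range_reflect, ← Finset.prod_range_add_one_eq_factorial]
  push_cast
  apply Finset.prod_congr rfl
  intro i hi
  rw [mem_range] at hi
  rw [Nat.cast_sub (by omega), Nat.cast_sub (by omega)]
  push_cast; ring

lemma prod_erase_eq (n k : ℕ) (hk : k ≤ n) :
    ∏ l ∈ (range (n + 1)).erase k, ((l : ℚ) - k) = (-1) ^ k * (k.factorial * (n - k).factorial) := by
  have h1 : ∏ l ∈ (range (n + 1)).erase k, ((l : ℚ) - k) =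
      ∏ l ∈ range (n + 1), (if l = k then 1 else (l : ℚ) - k) := by
    rw [← Finset.mul_prod_erase (range (n+1)) _ (mem_range.2 (show k < n + 1 by omega))]
    simp only [if_true, one_mul]
    apply Finset.prod_congr rfl
    intro l hl
    rw [if_neg (Finset.ne_of_mem_erase hl)]
  rw [h1]
  obtain ⟨m, rfl⟩ := Nat.exists_eq_add_of_le hk
  rw [show k + m + 1 = (k + 1) + m by ring, Finset.prod_range_add, Finset.prod_range_succ]
  simp only [if_true, mul_one, show k + m - k = m by omega]
  have h2 : ∏ l ∈ range k, (if l = k then 1 else (l : ℚ) - k) = (-1) ^ k * k.factorial := by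
    rw [← prod_rev_fact k, ← Finset.card_range k, ← Finset.prod_const, Finset.card_range,
      ← Finset.prod_mul_distrib]
    apply Finset.prod_congr rfl
    intro l hl
    rw [mem_range] at hl
    rw [if_neg (by omega)]; ring
  have h3 : ∏ l ∈ range m, (if k + 1 + l = k then 1 else ((k + 1 + l : ℕ) : ℚ) - k) = m.factorial := by
    rw [← Finset.prod_range_add_one_eq_factorial]
    push_cast
    apply Finset.prod_congr rfl
    intro l hl
    rw [if_neg (by omega)]; ring
  rw [h2, h3, mul_assoc]

lemma partial_fraction (n : ℕ) (x : ℚ) (hx : ∀ k ∈ range (n + 1), 1 + 4 * (x + (k : ℚ)) ≠ 0) :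
    ∑ k ∈ range (n + 1), rho n k / (1 + 4 * (x + k)) =
      32 ^ n * (∏ i ∈ range n, (x + (i + 1))) / ∏ k ∈ range (n + 1), (1 + 4 * (x + k)) := by
  classical
  set P : Polynomial ℚ := ∏ i ∈ range n, (Polynomial.X + Polynomial.C ((i : ℚ) + 1)) with hP
  set v : ℕ → ℚ := fun k => -((k : ℚ) + 1 / 4) with hv
  have hinj : Set.InjOn v (range (n + 1) : Finset ℕ) := by
    intro a _ b _ hab
    simp only [hv] at hab
    have : (a : ℚ) = b := by linarith
    exact_mod_cast this
  have hdeg : P.degree < (range (n + 1)).card := by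
    rw [hP, Polynomial.degree_prod, Finset.sum_congr rfl (fun i _ => Polynomial.degree_X_add_C _)]
    simp only [sum_const, card_range, nsmul_eq_mul, mul_one]
    exact_mod_cast Nat.lt_succ_self n
  have hPe : ∀ y, P.eval y = ∏ i ∈ range n, (y + (i + 1)) := by
    intro y; simp [hP, Polynomial.eval_prod]
  have hne : ∀ i ∈ range (n + 1), x ≠ v i := by
    intro i hi h
    apply hx i hi
    rw [h]; simp only [hv]; ring
  have hmain := congrArg (Polynomial.eval x) (Lagrange.eq_interpolate hinj hdeg)
  rw [Lagrange.eval_interpolate_not_at_node _ hne, Lagrange.eval_nodal, hPe] at hmain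
  rw [hmain]
  have hprod : ∏ i ∈ range (n + 1), (x - v i) = (∏ k ∈ range (n + 1), (1 + 4 * (x + k))) / 4 ^ (n + 1) := by
    rw [eq_div_iff (by positivity)]
    have : (4 : ℚ) ^ (n + 1) = ∏ k ∈ range (n + 1), 4 := by simp
    rw [this, ← Finset.prod_mul_distrib]
    apply Finset.prod_congr rfl
    intro k _
    simp only [hv]; ring
  have hD : ∏ k ∈ range (n + 1), (1 + 4 * (x + (k : ℚ))) ≠ 0 := Finset.prod_ne_zero_iff.2 hx
  rw [hprod]
  set D := ∏ k ∈ range (n + 1), (1 + 4 * (x + (k : ℚ)))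
  rw [show ∀ S : ℚ, 32 ^ n * (D / 4 ^ (n + 1) * S) / D = 32 ^ n / 4 ^ (n + 1) * S by
    intro S; field_simp, Finset.mul_sum]
  apply Finset.sum_congr rfl
  intro k hk
  have hk' : k ≤ n := by rw [mem_range] at hk; omega
  have hw : Lagrange.nodalWeight (range (n + 1)) v k = ((-1 : ℚ) ^ k * (k.factorial * (n - k).factorial))⁻¹ := by
    rw [Lagrange.nodalWeight, ← prod_erase_eq n k hk', ← Finset.prod_inv_distrib]
    apply Finset.prod_congr rfl
    intro l _
    simp only [hv]; congr 1; ring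
  rw [hw, hPe]
  have hvk : x - v k = (1 + 4 * (x + k)) / 4 := by simp only [hv]; ring
  have hPv : ∏ i ∈ range n, (v k + ((i : ℚ) + 1)) = (∏ i ∈ range n, (4 * ((i : ℚ) + 1 - k) - 1)) / 4 ^ n := by
    rw [eq_div_iff (by positivity)]
    have : (4 : ℚ) ^ n = ∏ k ∈ range n, 4 := by simp
    rw [this, ← Finset.prod_mul_distrib]
    apply Finset.prod_congr rfl
    intro i _
    simp only [hv]; ring
  rw [hvk, hPv, rho]
  have := hx k hk
  have hm1 : ((-1 : ℚ) ^ k) * (-1) ^ k = 1 := by rw [← mul_pow]; simp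
  have hm2 : ((-1 : ℚ) ^ k)⁻¹ = (-1) ^ k := by
    rw [inv_eq_iff_eq_inv, eq_comm]; exact inv_eq_of_mul_eq_one_left hm1
  rw [mul_inv, hm2, show (32 : ℚ) = 2 * 4 * 4 by norm_num, mul_pow, mul_pow, pow_succ]
  have f1 : (k.factorial : ℚ) ≠ 0 := by exact_mod_cast (Nat.factorial_pos _).ne'
  have f2 : ((n - k).factorial : ℚ) ≠ 0 := by exact_mod_cast (Nat.factorial_pos _).ne'
  field_simp

lemma rho_abs (n k : ℕ) (hk : k ≤ n) : |rho n k| ≤ 8 ^ n := by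
  have hb : |∏ i ∈ range n, (4 * ((i : ℚ) + 1 - k) - 1)| ≤ 4 ^ n * (k.factorial * (n - k).factorial) := by
    obtain ⟨m, rfl⟩ := Nat.exists_eq_add_of_le hk
    rw [Finset.prod_range_add, abs_mul, Finset.abs_prod, Finset.abs_prod, show k + m - k = m by omega]
    have h1 : ∏ i ∈ range k, |4 * ((i : ℚ) + 1 - k) - 1| ≤ 4 ^ k * k.factorial := by
      rw [← prod_rev_fact k, ← Finset.card_range k, ← Finset.prod_const, Finset.card_range,
        ← Finset.prod_mul_distrib]
      apply Finset.prod_le_prod (fun _ _ => abs_nonneg _)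
      intro i hi
      rw [mem_range] at hi
      have : (i : ℚ) + 1 ≤ k := by exact_mod_cast hi
      rw [abs_le]; constructor <;> linarith
    have h2 : ∏ i ∈ range m, |4 * (((k + i : ℕ) : ℚ) + 1 - k) - 1| ≤ 4 ^ m * m.factorial := by
      rw [← Finset.prod_range_add_one_eq_factorial m]
      push_cast
      rw [show (4 : ℚ) ^ m = ∏ i ∈ range m, 4 by simp, ← Finset.prod_mul_distrib]
      apply Finset.prod_le_prod (fun _ _ => abs_nonneg _)
      intro i hi
      have : (0 : ℚ) ≤ i := by positivity
      rw [abs_le]; constructor <;> linarith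
    calc _ ≤ (4 ^ k * k.factorial : ℚ) * (4 ^ m * m.factorial) :=
          mul_le_mul h1 h2 (Finset.prod_nonneg fun _ _ => abs_nonneg _) (by positivity)
      _ = _ := by rw [pow_add]; ring
  rw [rho, abs_mul, abs_div, abs_mul, abs_pow, abs_pow, abs_neg, abs_one, one_pow, mul_one]
  have f1 : (0 : ℚ) < k.factorial := by exact_mod_cast (Nat.factorial_pos _)
  have f2 : (0 : ℚ) < (n - k).factorial := by exact_mod_cast (Nat.factorial_pos _)
  rw [abs_of_pos (mul_pos f1 f2), abs_of_pos (by norm_num : (0 : ℚ) < 2)]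
  calc _ ≤ 2 ^ n / ((k.factorial : ℚ) * (n - k).factorial) * (4 ^ n * (k.factorial * (n - k).factorial)) := by
        gcongr
    _ = 2 ^ n * 4 ^ n := by field_simp
    _ = 8 ^ n := by rw [← mul_pow]; norm_num

lemma ap_dvd (n i : ℕ) (hi : i < n) (c : ℤ) :
    (n.factorial : ℤ) ∣ dn n * (2 ^ n * ∏ j ∈ (range n).erase i, (4 * (j : ℤ) + c)) := by
  obtain ⟨v, K, hK, hvK⟩ := Nat.exists_eq_two_pow_mul_odd (Nat.factorial_pos n).ne'
  have hv : v ≤ n := by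
    have h1 : 2 ^ v ∣ n.factorial := ⟨K, hvK⟩
    have := (padicValNat_dvd_iff_le (p := 2) (Nat.factorial_pos n).ne').1 h1
    exact this.trans (padicValNat_factorial_le (p := 2) n)
  have hKn : (K : ℤ) ∣ (n.factorial : ℤ) := by
    rw [hvK]; exact_mod_cast Dvd.intro_left _ rfl
  have hcons : ∀ B : ℤ, (n.factorial : ℤ) ∣ dn n * ∏ j ∈ (range n).erase i, ((j : ℤ) + B) := by
    intro B
    have hsplit : ∏ j ∈ (range n).erase i, ((j : ℤ) + B) =
        (∏ j ∈ range i, (B + j)) * ∏ j ∈ range (n - i - 1), (B + i + 1 + j) := by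
      have h1 : ∏ l ∈ (range n).erase i, ((l : ℤ) + B) =
          ∏ l ∈ range n, (if l = i then 1 else (l : ℤ) + B) := by
        rw [← Finset.mul_prod_erase (range n) _ (mem_range.2 hi)]
        simp only [if_true, one_mul]
        apply Finset.prod_congr rfl
        intro l hl
        rw [if_neg (Finset.ne_of_mem_erase hl)]
      rw [h1]
      obtain ⟨m, rfl⟩ := Nat.exists_eq_add_of_lt hi
      rw [show i + m + 1 = (i + 1) + m by ring, Finset.prod_range_add, Finset.prod_range_succ,
        show i + 1 + m - i - 1 = m by omega]
      simp only [if_true, mul_one]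
      congr 1
      · apply Finset.prod_congr rfl
        intro l hl
        rw [mem_range] at hl
        rw [if_neg (by omega)]; ring
      · apply Finset.prod_congr rfl
        intro l hl
        rw [if_neg (by omega)]; push_cast; ring
    rw [hsplit]
    have h2 := mul_dvd_mul (Nat.factorial_coe_dvd_prod i B) (Nat.factorial_coe_dvd_prod (n - i - 1) (B + i + 1))
    have h3 := leibniz i (n - i - 1)
    rw [show i + (n - i - 1) + 1 = n by omega] at h3
    have h4 : (n.factorial : ℤ) ∣ dn n * (i.factorial * (n - i - 1).factorial) := by exact_mod_cast h3
    exact h4.trans (mul_dvd_mul dvd_rfl h2)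
  have hcop : IsCoprime (4 : ℤ) (K : ℤ) := by
    rw [show (4 : ℤ) = ((4 : ℕ) : ℤ) by norm_num, Nat.isCoprime_iff_coprime]
    rw [show 4 = 2 ^ 2 by norm_num]
    exact Nat.Coprime.pow_left 2 (Nat.coprime_two_left.2 hK)
  obtain ⟨a, b, hab⟩ := hcop
  have hmod : ∏ j ∈ (range n).erase i, (4 * (j : ℤ) + c) ≡
      ∏ j ∈ (range n).erase i, (4 * ((j : ℤ) + a * c)) [ZMOD K] := by
    apply Int.ModEq.prod
    intro j _
    rw [Int.modEq_iff_dvd]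
    refine ⟨-(b * c), ?_⟩
    linear_combination c * hab
  have hK2 : (K : ℤ) ∣ dn n * ∏ j ∈ (range n).erase i, (4 * (j : ℤ) + c) := by
    have h := (hmod.mul_left (dn n : ℤ))
    rw [h.dvd_iff, Finset.prod_mul_distrib, mul_left_comm]
    exact (hKn.trans (hcons (a * c))).mul_left _
  rw [mul_left_comm, hvK]
  push_cast
  exact mul_dvd_mul (pow_dvd_pow 2 hv) hK2

lemma odd_ne (z : ℤ) : (1 + 4 * (z : ℚ)) ≠ 0 := by
  have : (1 + 4 * z : ℤ) ≠ 0 := by omega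
  exact_mod_cast this

lemma rho_int (n k i : ℕ) (hk : k ≤ n) (hi : i < n) :
    ∃ z : ℤ, (dn n : ℚ) * (rho n k / (1 + 4 * ((k : ℚ) - (i + 1)))) = z := by
  obtain ⟨y, hy⟩ := ap_dvd n i hi (4 * (1 - k) - 1)
  refine ⟨-((-1) ^ k * n.choose k * y), ?_⟩
  have hy' : (dn n : ℚ) * (2 ^ n * ∏ j ∈ (range n).erase i, (4 * (j : ℚ) + (4 * (1 - k) - 1))) = n.factorial * y := by
    exact_mod_cast hy
  have hne : (1 + 4 * ((k : ℚ) - (i + 1))) ≠ 0 := by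
    have := odd_ne (k - (i + 1)); push_cast at this; exact this
  have hp : ∏ j ∈ range n, (4 * ((j : ℚ) + 1 - k) - 1) =
      -(1 + 4 * ((k : ℚ) - (i + 1))) * ∏ j ∈ (range n).erase i, (4 * (j : ℚ) + (4 * (1 - k) - 1)) := by
    rw [← Finset.mul_prod_erase (range n) _ (mem_range.2 hi)]
    congr 1
    · ring
    · apply Finset.prod_congr rfl; intro j _; ring
  have hc : (n.choose k : ℚ) * (k.factorial * (n - k).factorial) = n.factorial := by
    have := Nat.choose_mul_factorial_mul_factorial hk
    rw [mul_assoc] at this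
    exact_mod_cast this
  rw [rho, hp]
  have f1 : (k.factorial : ℚ) ≠ 0 := by exact_mod_cast (Nat.factorial_pos _).ne'
  have f2 : ((n - k).factorial : ℚ) ≠ 0 := by exact_mod_cast (Nat.factorial_pos _).ne'
  set Q := ∏ j ∈ (range n).erase i, (4 * (j : ℚ) + (4 * (1 - k) - 1))
  rw [show (dn n : ℚ) * (2 ^ n * (-1) ^ k / (↑k.factorial * ↑(n - k).factorial) * (-(1 + 4 * (↑k - (↑i + 1))) * Q) /
      (1 + 4 * (↑k - (↑i + 1)))) = - ((-1) ^ k * ((dn n : ℚ) * (2 ^ n * Q)) / (↑k.factorial * ↑(n - k).factorial)) by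
    field_simp, hy', ← hc]
  push_cast
  field_simp

def qq (n : ℕ) : ℚ := ∑ k ∈ range (n + 1), rho n k * rho n k

def pp (n : ℕ) : ℚ := ∑ k ∈ range (n + 1), ∑ j ∈ range k, ∑ l ∈ range (n + 1),
  2 / ((l : ℚ) - k) * (rho n k / (1 + 4 * j)) * (rho n l / (1 + 4 * ((l : ℚ) - k + j)))

def TT (k : ℕ) : ℚ := ∑ j ∈ range k, -(4 / (1 + 4 * (j : ℚ)) ^ 2)

def SS (k : ℕ) : ℚ := ∑ j ∈ range k, -(8 / (1 + 4 * (j : ℚ)) ^ 3)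

lemma rho_zero (n k j : ℕ) (hk : k ≤ n) (hj : j < k) :
    ∑ l ∈ range (n + 1), rho n l / (1 + 4 * ((l : ℚ) - k + j)) = 0 := by
  have h := partial_fraction n (-((k : ℚ) - j)) (by
    intro l _
    have := odd_ne (-((k : ℤ) - j) + l)
    push_cast at this; exact this)
  have h0 : ∏ i ∈ range n, (-((k : ℚ) - j) + (i + 1)) = 0 := by
    apply Finset.prod_eq_zero (mem_range.2 (show k - j - 1 < n by omega))
    rw [Nat.cast_sub (by omega), Nat.cast_sub (by omega)]
    push_cast; ring
  rw [h0, mul_zero, zero_div] at h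
  rw [← h]
  apply Finset.sum_congr rfl
  intro l _
  congr 2; ring

lemma pp_term (n k j : ℕ) (hk : k ≤ n) (hj : j < k) :
    ∑ l ∈ range (n + 1),
      2 / ((l : ℚ) - k) * (rho n k / (1 + 4 * j)) * (rho n l / (1 + 4 * ((l : ℚ) - k + j))) =
    8 / (1 + 4 * (j : ℚ)) ^ 3 * (rho n k * rho n k) +
      ∑ l ∈ range (n + 1), rho n k * rho n l * (2 / (1 + 4 * (j : ℚ)) ^ 2 / ((l : ℚ) - k)) := by
  have hz := rho_zero n k j hk hj
  have hm : (1 + 4 * (j : ℚ)) ≠ 0 := by positivity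
  have hterm : ∀ l ∈ range (n + 1),
      2 / ((l : ℚ) - k) * (rho n k / (1 + 4 * j)) * (rho n l / (1 + 4 * ((l : ℚ) - k + j))) =
      (if l = k then 8 / (1 + 4 * (j : ℚ)) ^ 3 * (rho n k * rho n k) else 0) +
      rho n k * rho n l * (2 / (1 + 4 * (j : ℚ)) ^ 2 / ((l : ℚ) - k)) -
      8 * rho n k / (1 + 4 * (j : ℚ)) ^ 2 * (rho n l / (1 + 4 * ((l : ℚ) - k + j))) := by
    intro l _
    by_cases h : l = k
    · subst h
      simp only [sub_self, div_zero, if_true, zero_mul, mul_zero, zero_add, add_zero]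
      field_simp
      ring
    · rw [if_neg h]
      have h1 : (l : ℚ) - k ≠ 0 := by
        rw [sub_ne_zero]; exact_mod_cast h
      have h2 : (1 + 4 * ((l : ℚ) - k + j)) ≠ 0 := by
        have := odd_ne ((l : ℤ) - k + j); push_cast at this; exact this
      generalize (l : ℚ) - k = a at *
      field_simp
      ring
  rw [Finset.sum_congr rfl hterm, Finset.sum_sub_distrib, Finset.sum_add_distrib, ← Finset.mul_sum, hz,
    Finset.sum_ite_eq' , if_pos (mem_range.2 (by omega))]
  ring

lemma pp_eq (n : ℕ) : pp n = -(∑ k ∈ range (n + 1), rho n k * rho n k * SS k) -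
    ∑ k ∈ range (n + 1), ∑ l ∈ range (n + 1), rho n k * rho n l * ((TT k - TT l) / (4 * ((l : ℚ) - k))) := by
  have hsym : ∑ k ∈ range (n + 1), ∑ l ∈ range (n + 1), rho n k * rho n l * ((TT k - TT l) / (4 * ((l : ℚ) - k)))
      = ∑ k ∈ range (n + 1), ∑ l ∈ range (n + 1), rho n k * rho n l * (TT k / (2 * ((l : ℚ) - k))) := by
    have h1 : ∑ k ∈ range (n + 1), ∑ l ∈ range (n + 1), rho n k * rho n l * (TT l / (4 * ((l : ℚ) - k)))
       = - ∑ k ∈ range (n + 1), ∑ l ∈ range (n + 1), rho n k * rho n l * (TT k / (4 * ((l : ℚ) - k))) := by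
      rw [Finset.sum_comm, ← Finset.sum_neg_distrib]
      apply Finset.sum_congr rfl; intro k _
      rw [← Finset.sum_neg_distrib]
      apply Finset.sum_congr rfl; intro l _
      rw [show (4 * ((k : ℚ) - l)) = -(4 * ((l : ℚ) - k)) by ring, div_neg]
      ring
    simp only [sub_div, mul_sub, Finset.sum_sub_distrib] at h1 ⊢
    rw [h1, sub_neg_eq_add, ← Finset.sum_add_distrib]
    apply Finset.sum_congr rfl; intro k _
    rw [← Finset.sum_add_distrib]
    apply Finset.sum_congr rfl; intro l _
    rw [← mul_sub, ← mul_sub, ← mul_add]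
    congr 1
    rw [mul_comm (4 : ℚ), mul_comm (2 : ℚ), ← div_div, ← div_div]
    ring
  rw [hsym, pp, ← Finset.sum_neg_distrib, ← Finset.sum_sub_distrib]
  apply Finset.sum_congr rfl
  intro k hk
  rw [mem_range] at hk
  rw [Finset.sum_congr rfl (fun j hj => pp_term n k j (by omega) (mem_range.1 hj)), Finset.sum_add_distrib]
  rw [sub_eq_add_neg]
  congr 1
  · rw [SS, Finset.sum_neg_distrib, mul_neg, neg_neg, ← Finset.sum_mul, mul_comm]
  · rw [Finset.sum_comm, ← Finset.sum_neg_distrib]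
    apply Finset.sum_congr rfl; intro l _
    rw [← Finset.mul_sum, ← mul_neg]
    congr 1
    rw [TT, ← Finset.sum_div, ← neg_div, Finset.sum_neg_distrib]
    rw [show -(-∑ j ∈ range k, 4 / (1 + 4 * (j : ℚ)) ^ 2) = ∑ j ∈ range k, 4 / (1 + 4 * (j : ℚ)) ^ 2 by ring]
    by_cases h : (l : ℚ) - k = 0
    · rw [h]; simp
    · rw [eq_comm, div_eq_div_iff (by simpa using h) h, ← mul_assoc, Finset.sum_mul, Finset.sum_mul, Finset.sum_mul]
      apply Finset.sum_congr rfl; intro j _; ring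


lemma dn_div_int (n k l : ℕ) (hk : k ≤ n) (hl : l ≤ n) :
    (dn n : ℚ) * (2 / ((l : ℚ) - k)) ∈ (Int.castRingHom ℚ).range := by
  rcases lt_trichotomy l k with h | h | h
  · obtain ⟨z, hz⟩ := dn_dvd (show 1 ≤ k - l by omega) (show k - l ≤ n by omega)
    have hne : (k : ℚ) - l ≠ 0 := by
      rw [sub_ne_zero]; exact_mod_cast h.ne'
    refine ⟨-(2 * z), ?_⟩
    rw [hz, Nat.cast_mul, Nat.cast_sub h.le, show (l : ℚ) - k = -((k : ℚ) - l) by ring]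
    push_cast [Int.coe_castRingHom]
    field_simp
  · subst h
    exact ⟨0, by simp⟩
  · obtain ⟨z, hz⟩ := dn_dvd (show 1 ≤ l - k by omega) (show l - k ≤ n by omega)
    have hne : (l : ℚ) - k ≠ 0 := by
      rw [sub_ne_zero]; exact_mod_cast h.ne'
    refine ⟨2 * z, ?_⟩
    rw [hz, Nat.cast_mul, Nat.cast_sub h.le]
    push_cast [Int.coe_castRingHom]
    field_simp

lemma rho_int' (n k l j : ℕ) (hk : k ≤ n) (hl : l ≤ n) (hj : j < k) :
    (dn n : ℚ) * (rho n l / (1 + 4 * ((l : ℚ) - k + j))) ∈ (Int.castRingHom ℚ).range := by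
  obtain ⟨z, hz⟩ := rho_int n l (k - j - 1) hl (by omega)
  refine ⟨z, ?_⟩
  show (z : ℚ) = _
  rw [← hz, Nat.cast_sub (by omega), Nat.cast_sub (by omega)]
  congr 3; push_cast; ring

lemma pp_int (n : ℕ) : ∃ z : ℤ, (dn n : ℚ) ^ 3 * pp n = z := by
  have : (dn n : ℚ) ^ 3 * pp n ∈ (Int.castRingHom ℚ).range := by
    rw [pp, Finset.mul_sum]
    refine sum_mem fun k hk => ?_
    rw [mem_range] at hk
    rw [Finset.mul_sum]
    refine sum_mem fun j hj => ?_
    rw [mem_range] at hj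
    rw [Finset.mul_sum]
    refine sum_mem fun l hl => ?_
    rw [mem_range] at hl
    have h1 := dn_div_int n k l (by omega) (by omega)
    have h2 := rho_int' n k k j (by omega) (by omega) hj
    have h3 := rho_int' n k l j (by omega) (by omega) hj
    rw [sub_self, zero_add] at h2
    have := mul_mem (mul_mem h1 h2) h3
    convert this using 1
    ring
  obtain ⟨z, hz⟩ := this
  exact ⟨z, hz.symm⟩

lemma qq_int (n : ℕ) (hn : 1 ≤ n) : ∃ z : ℤ, (dn n : ℚ) ^ 3 * qq n = z := by
  have : (dn n : ℚ) ^ 3 * qq n ∈ (Int.castRingHom ℚ).range := by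
    rw [qq, Finset.mul_sum]
    refine sum_mem fun k hk => ?_
    rw [mem_range] at hk
    have h1 := rho_int' n 1 k 0 hn (by omega) (by omega)
    have h2 : (dn n : ℚ) ∈ (Int.castRingHom ℚ).range := ⟨dn n, by simp⟩
    have h3 : (1 + 4 * ((k : ℚ) - (1 : ℕ) + (0 : ℕ))) ∈ (Int.castRingHom ℚ).range :=
      ⟨1 + 4 * (k - 1), by simp⟩
    have hne : (1 + 4 * ((k : ℚ) - (1 : ℕ) + (0 : ℕ))) ≠ 0 := by
      have := odd_ne ((k : ℤ) - 1); push_cast at this ⊢; rwa [add_zero]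
    have h4 : (dn n : ℚ) * rho n k ∈ (Int.castRingHom ℚ).range := by
      have := mul_mem h1 h3
      rwa [mul_assoc, div_mul_cancel₀ _ hne] at this
    have := mul_mem (mul_mem h2 h4) h4
    convert this using 1
    ring
  obtain ⟨z, hz⟩ := this
  exact ⟨z, hz.symm⟩

lemma one_le_odd (z : ℤ) : 1 ≤ |1 + 4 * (z : ℚ)| := by
  have : (1 : ℤ) ≤ |1 + 4 * z| := Int.one_le_abs (by omega)
  exact_mod_cast this

lemma qq_abs (n : ℕ) : |qq n| ≤ (n + 1) * 64 ^ n := by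
  rw [qq]
  refine (Finset.abs_sum_le_sum_abs _ _).trans ?_
  refine (Finset.sum_le_card_nsmul _ _ (64 ^ n) ?_).trans (by simp)
  intro k hk
  rw [mem_range] at hk
  have := rho_abs n k (by omega)
  rw [abs_mul, show (64 : ℚ) = 8 * 8 by norm_num, mul_pow]
  gcongr

lemma pp_abs (n : ℕ) : |pp n| ≤ 2 * (n + 1) ^ 3 * 64 ^ n := by
  rw [pp]
  have hterm : ∀ k ∈ range (n + 1), ∀ j ∈ range k, ∀ l ∈ range (n + 1),
      |2 / ((l : ℚ) - k) * (rho n k / (1 + 4 * j)) * (rho n l / (1 + 4 * ((l : ℚ) - k + j)))| ≤ 2 * 64 ^ n := by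
    intro k hk j hj l hl
    rw [mem_range] at hk hl
    have h1 := rho_abs n k (by omega)
    have h2 := rho_abs n l (by omega)
    have h3 : 1 ≤ |1 + 4 * (j : ℚ)| := by have := one_le_odd j; exact_mod_cast this
    have h4 : 1 ≤ |1 + 4 * ((l : ℚ) - k + j)| := by
      have := one_le_odd ((l : ℤ) - k + j); push_cast at this; exact this
    have h5 : |2 / ((l : ℚ) - k)| ≤ 2 := by
      by_cases h : l = k
      · subst h; simp
      · have : (1 : ℤ) ≤ |(l : ℤ) - k| := Int.one_le_abs (by omega)
        have : (1 : ℚ) ≤ |(l : ℚ) - k| := by exact_mod_cast this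
        rw [abs_div, abs_of_pos (by norm_num : (0 : ℚ) < 2)]
        exact div_le_self (by norm_num) this
    rw [abs_mul, abs_mul, abs_div (rho n k), abs_div (rho n l)]
    have h6 : |rho n k| / |1 + 4 * (j : ℚ)| ≤ 8 ^ n := (div_le_self (abs_nonneg _) h3).trans h1
    have h7 : |rho n l| / |1 + 4 * ((l : ℚ) - k + j)| ≤ 8 ^ n := (div_le_self (abs_nonneg _) h4).trans h2
    calc _ ≤ (2 : ℚ) * 8 ^ n * 8 ^ n := by gcongr
      _ = _ := by rw [mul_assoc, ← mul_pow]; norm_num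
  refine (Finset.abs_sum_le_sum_abs _ _).trans ?_
  calc _ ≤ ∑ k ∈ range (n + 1), ((n : ℚ) + 1) * ((n + 1) * (2 * 64 ^ n)) := by
        apply Finset.sum_le_sum
        intro k hk
        refine (Finset.abs_sum_le_sum_abs _ _).trans ?_
        have : ∀ j ∈ range k, |∑ l ∈ range (n + 1), 2 / ((l : ℚ) - k) * (rho n k / (1 + 4 * j)) *
            (rho n l / (1 + 4 * ((l : ℚ) - k + j)))| ≤ (n + 1) * (2 * 64 ^ n) := by
          intro j hj
          refine (Finset.abs_sum_le_sum_abs _ _).trans ?_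
          refine (Finset.sum_le_card_nsmul _ _ _ (hterm k hk j hj)).trans (by simp)
        refine (Finset.sum_le_card_nsmul _ _ _ this).trans ?_
        rw [card_range, nsmul_eq_mul]
        have : (k : ℚ) ≤ n + 1 := by rw [mem_range] at hk; exact_mod_cast hk.le
        gcongr
    _ = _ := by
      rw [sum_const, card_range, nsmul_eq_mul]; push_cast; ring


lemma norm_nat_le_of_dvd {a m : ℕ} (h : 2 ^ m ∣ a) : ‖(a : ℚ_[2])‖ ≤ (1 / 2) ^ m := by
  have := (Padic.norm_int_le_pow_iff_dvd (p := 2) (a : ℤ) m).2 (by exact_mod_cast h)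
  simpa [zpow_neg] using this

lemma norm_two_pow (m : ℕ) : ‖(2 : ℚ_[2]) ^ m‖ = (1 / 2) ^ m := by
  rw [norm_pow]
  have := Padic.norm_p (p := 2)
  push_cast at this
  rw [this]; simp

lemma norm_odd (z : ℤ) : ‖(1 + 4 * (z : ℚ_[2]))‖ = 1 := by
  have h1 : ‖((1 + 4 * z : ℤ) : ℚ_[2])‖ ≤ 1 := Padic.norm_int_le_one _
  have h2 : ¬ ‖((1 + 4 * z : ℤ) : ℚ_[2])‖ < 1 := by
    rw [Padic.norm_intCast_lt_one_iff]
    push_cast; omega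
  push_cast at h1 h2
  exact le_antisymm h1 (not_lt.1 h2)

lemma norm_odd_nat (a : ℕ) : ‖(1 + 4 * (a : ℚ_[2]))‖ = 1 := by
  have := norm_odd a
  exact_mod_cast this

lemma odd_nat_ne (a : ℕ) : (1 + 4 * (a : ℚ_[2])) ≠ 0 := by
  intro h
  have := norm_odd_nat a
  rw [h, norm_zero] at this
  exact zero_ne_one this

noncomputable def av (M : ℕ) (g : ℕ → ℚ_[2]) : ℚ_[2] := (∑ t ∈ range (2 ^ M), g t) / 2 ^ M

lemma av_succ (M : ℕ) (g : ℕ → ℚ_[2]) :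
    av (M + 1) g = av M g + (∑ t ∈ range (2 ^ M), (g (t + 2 ^ M) - g t)) / 2 ^ (M + 1) := by
  rw [av, av, pow_succ 2 M, mul_two, Finset.sum_range_add, Finset.sum_sub_distrib]
  rw [Finset.sum_congr rfl (fun t _ => by rw [add_comm] : ∀ t ∈ range (2 ^ M), g (2 ^ M + t) = g (t + 2 ^ M))]
  rw [pow_succ (2 : ℚ_[2])]
  field_simp
  ring

lemma sum_norm_le {s : Finset ℕ} {f : ℕ → ℚ_[2]} {C : ℝ} (hC : 0 ≤ C) (h : ∀ i ∈ s, ‖f i‖ ≤ C) :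
    ‖∑ i ∈ s, f i‖ ≤ C :=
  IsUltrametricDist.norm_sum_le_of_forall_le_of_nonneg hC h

lemma av_close (g : ℕ → ℚ_[2]) (hg : ∀ m y, ‖g (y + 2 ^ m) - g y‖ ≤ (1 / 2) ^ (m + 2)) (m : ℕ) :
    ‖av m g - g 0‖ ≤ 1 / 2 := by
  induction m with
  | zero => simp [av]
  | succ m ih =>
    rw [av_succ, add_sub_right_comm]
    refine (Padic.nonarchimedean _ _).trans (max_le ih ?_)
    rw [norm_div, norm_two_pow, div_le_iff₀ (by positivity)]
    refine (sum_norm_le (by positivity) (fun t _ => hg m t)).trans ?_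
    rw [pow_succ' (1 / 2 : ℝ) (m + 1)]

lemma inv_lip (a b : ℕ) : ‖(1 + 4 * ((a + b : ℕ) : ℚ_[2]))⁻¹ - (1 + 4 * (a : ℚ_[2]))⁻¹‖ ≤ ‖(b : ℚ_[2])‖ * (1 / 4) := by
  have h1 := odd_nat_ne a
  have h2 := odd_nat_ne (a + b)
  have : (1 + 4 * ((a + b : ℕ) : ℚ_[2]))⁻¹ - (1 + 4 * (a : ℚ_[2]))⁻¹ =
      -(b * 2 ^ 2) * ((1 + 4 * ((a + b : ℕ) : ℚ_[2]))⁻¹ * (1 + 4 * (a : ℚ_[2]))⁻¹) := by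
    field_simp
    push_cast; ring
  rw [this, norm_mul, norm_mul, norm_inv, norm_inv, norm_odd_nat, norm_odd_nat, norm_neg, norm_mul, norm_two_pow]
  norm_num

lemma mul_lip {a a' b b' : ℚ_[2]} {e : ℝ} (ha : ‖a‖ ≤ 1) (hb' : ‖b'‖ ≤ 1)
    (h1 : ‖a' - a‖ ≤ e) (h2 : ‖b' - b‖ ≤ e) : ‖a' * b' - a * b‖ ≤ e := by
  rw [show a' * b' - a * b = (a' - a) * b' + a * (b' - b) by ring]
  refine (Padic.nonarchimedean _ _).trans (max_le ?_ ?_)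
  · rw [norm_mul]
    exact (mul_le_of_le_one_right (norm_nonneg _) hb').trans h1
  · rw [norm_mul]
    exact (mul_le_of_le_one_left (norm_nonneg _) ha).trans h2

lemma prod_lip (s : Finset ℕ) (f f' : ℕ → ℚ_[2]) {e : ℝ} (he : 0 ≤ e) (hf : ∀ i, ‖f i‖ ≤ 1) (hf' : ∀ i, ‖f' i‖ ≤ 1)
    (h : ∀ i, ‖f' i - f i‖ ≤ e) : ‖∏ i ∈ s, f' i - ∏ i ∈ s, f i‖ ≤ e := by
  induction s using Finset.induction_on with
  | empty => simpa using he
  | insert a s ha ih =>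
    rw [Finset.prod_insert ha, Finset.prod_insert ha]
    refine mul_lip (hf a) ?_ (h a) ih
    rw [norm_prod]
    exact Finset.prod_le_one (fun _ _ => norm_nonneg _) (fun i _ => hf' i)

lemma exists_W : ∃ W : ℚ_[2], Tendsto (fun M => av M (fun t => ((1 + 4 * (t : ℚ_[2])) ^ 2)⁻¹)) atTop (nhds W) := by
  apply cauchySeq_tendsto_of_complete
  apply cauchySeq_of_le_geometric (1 / 2) 2 (by norm_num)
  intro M
  rw [dist_comm, dist_eq_norm, av_succ, add_sub_cancel_left]
  have h3 : ‖av M (fun t => ((1 + 4 * (t : ℚ_[2]))⁻¹) ^ 3)‖ ≤ 1 := by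
    have h := av_close (fun t => ((1 + 4 * (t : ℚ_[2]))⁻¹) ^ 3) (by
      intro m y
      have e : ‖(1 + 4 * ((y + 2 ^ m : ℕ) : ℚ_[2]))⁻¹ - (1 + 4 * (y : ℚ_[2]))⁻¹‖ ≤ (1 / 2) ^ (m + 2) := by
        refine (inv_lip y (2 ^ m)).trans ?_
        push_cast
        rw [norm_two_pow, pow_add]; norm_num
      have n1 : ‖(1 + 4 * ((y + 2 ^ m : ℕ) : ℚ_[2]))⁻¹‖ ≤ 1 := by rw [norm_inv, norm_odd_nat]; simp
      have n2 : ‖(1 + 4 * (y : ℚ_[2]))⁻¹‖ ≤ 1 := by rw [norm_inv, norm_odd_nat]; simp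
      simp only [pow_succ (_ : ℚ_[2]) 2, pow_two]
      refine mul_lip ?_ n1 (mul_lip n2 n1 e e) e
      rw [norm_mul]; exact mul_le_one₀ n2 (norm_nonneg _) n2) M
    have h0 : ‖((1 + 4 * ((0 : ℕ) : ℚ_[2]))⁻¹) ^ 3‖ ≤ 1 := by simp
    calc _ = ‖(av M (fun t => ((1 + 4 * (t : ℚ_[2]))⁻¹) ^ 3) - ((1 + 4 * ((0 : ℕ) : ℚ_[2]))⁻¹) ^ 3)
              + ((1 + 4 * ((0 : ℕ) : ℚ_[2]))⁻¹) ^ 3‖ := by rw [sub_add_cancel]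
      _ ≤ 1 := (Padic.nonarchimedean _ _).trans (max_le (h.trans (by norm_num)) h0)
  have hterm : ∀ t ∈ range (2 ^ M), ((1 + 4 * ((t + 2 ^ M : ℕ) : ℚ_[2])) ^ 2)⁻¹ - ((1 + 4 * (t : ℚ_[2])) ^ 2)⁻¹ =
      -(2 ^ (M + 3)) * ((1 + 4 * (t : ℚ_[2]))⁻¹) ^ 3 +
        2 ^ (2 * M) * (((48 * (1 + 4 * t) + 128 * 2 ^ M : ℕ) : ℚ_[2]) *
          ((1 + 4 * (t : ℚ_[2]))⁻¹ ^ 3 * (1 + 4 * ((t + 2 ^ M : ℕ) : ℚ_[2]))⁻¹ ^ 2)) := by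
    intro t _
    have h1 := odd_nat_ne t
    have h2 := odd_nat_ne (t + 2 ^ M)
    push_cast at h2 ⊢
    rw [pow_add, pow_mul' ]
    generalize (2 : ℚ_[2]) ^ M = h at *
    field_simp
    ring
  rw [Finset.sum_congr rfl hterm, Finset.sum_add_distrib, ← Finset.mul_sum, ← Finset.mul_sum, add_div]
  refine (Padic.nonarchimedean _ _).trans (max_le ?_ ?_)
  · have : -(2 ^ (M + 3)) * (∑ t ∈ range (2 ^ M), ((1 + 4 * (t : ℚ_[2]))⁻¹) ^ 3) / 2 ^ (M + 1) =
        -(2 ^ (M + 2)) * av M (fun t => ((1 + 4 * (t : ℚ_[2]))⁻¹) ^ 3) := by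
      rw [av]; simp only [pow_add]; field_simp
    rw [this, norm_mul, norm_neg, norm_two_pow]
    calc _ ≤ (1 / 2 : ℝ) ^ (M + 2) * 1 := by gcongr
      _ ≤ _ := by
        rw [pow_add]; have : (0 : ℝ) < (1 / 2) ^ M := by positivity
        nlinarith
  · rw [norm_div, norm_mul, norm_two_pow, norm_two_pow, div_le_iff₀ (by positivity)]
    have hs : ‖∑ t ∈ range (2 ^ M), (((48 * (1 + 4 * t) + 128 * 2 ^ M : ℕ) : ℚ_[2]) *
          ((1 + 4 * (t : ℚ_[2]))⁻¹ ^ 3 * (1 + 4 * ((t + 2 ^ M : ℕ) : ℚ_[2]))⁻¹ ^ 2))‖ ≤ 1 := by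
      apply sum_norm_le (by norm_num)
      intro t _
      rw [norm_mul, norm_mul, norm_pow, norm_pow, norm_inv, norm_inv, norm_odd_nat, norm_odd_nat]
      simpa using Padic.norm_int_le_one (p := 2) ((48 * (1 + 4 * t) + 128 * 2 ^ M : ℕ) : ℤ)
    calc _ ≤ (1 / 2 : ℝ) ^ (2 * M) * 1 := by gcongr
      _ = 2 * (1 / 2) ^ M * (1 / 2) ^ (M + 1) := by
        rw [two_mul, pow_add, pow_succ]; ring


noncomputable def hh (n t : ℕ) : ℚ_[2] :=
  ((t + n).choose n : ℚ_[2]) * ∏ k ∈ range (n + 1), (1 + 4 * ((t + k : ℕ) : ℚ_[2]))⁻¹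

lemma norm_nat_le_one (a : ℕ) : ‖(a : ℚ_[2])‖ ≤ 1 := by
  simpa using Padic.norm_int_le_one (p := 2) (a : ℤ)

lemma norm_prod_inv (n t : ℕ) : ‖∏ k ∈ range (n + 1), (1 + 4 * ((t + k : ℕ) : ℚ_[2]))⁻¹‖ = 1 := by
  rw [norm_prod]
  apply Finset.prod_eq_one
  intro k _
  rw [norm_inv, norm_odd_nat, inv_one]

lemma hh_norm (n t : ℕ) : ‖hh n t‖ = ‖((t + n).choose n : ℚ_[2])‖ := by
  rw [hh, norm_mul, norm_prod_inv, mul_one]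

lemma hh_norm_le (n t : ℕ) : ‖hh n t‖ ≤ 1 := by
  rw [hh_norm]; exact norm_nat_le_one _

lemma choose_pow_dvd (s m i : ℕ) (hi : 0 < i) (hi2 : i < 2 ^ s) : 2 ^ (m + 1) ∣ (2 ^ (s + m)).choose i := by
  have h0 : (2 ^ (s + m)).choose i ≠ 0 := by
    apply (Nat.choose_pos _).ne'
    exact hi2.le.trans (Nat.pow_le_pow_right (by norm_num) (by omega))
  have h1 : i * (2 ^ (s + m)).choose i = 2 ^ (s + m) * (2 ^ (s + m) - 1).choose (i - 1) := by
    have := Nat.add_one_mul_choose_eq (2 ^ (s + m) - 1) (i - 1)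
    rw [Nat.sub_add_cancel Nat.one_le_two_pow, Nat.sub_add_cancel hi] at this
    linarith
  have h2 : 2 ^ (s + m) ∣ i * (2 ^ (s + m)).choose i := ⟨_, h1⟩
  rw [padicValNat_dvd_iff_le (by positivity), padicValNat.mul hi.ne' h0] at h2
  rw [padicValNat_dvd_iff_le h0]
  have h3 : padicValNat 2 i < s := by
    by_contra hc
    push Not at hc
    have := (padicValNat_dvd_iff_le (p := 2) hi.ne').2 hc
    have := Nat.le_of_dvd hi this
    omega
  omega

lemma choose_lip (s m a : ℕ) :
    ‖(((a + 2 ^ (s + m)).choose (2 ^ s - 1) : ℕ) : ℚ_[2]) - (a.choose (2 ^ s - 1) : ℕ)‖ ≤ (1 / 2) ^ (m + 1) := by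
  have hs : 1 ≤ 2 ^ s := Nat.one_le_two_pow
  rw [add_comm a, Nat.add_choose_eq, Finset.Nat.sum_antidiagonal_eq_sum_range_succ_mk, Finset.sum_range_succ']
  simp only [Nat.choose_zero_right, one_mul, Nat.sub_zero]
  push_cast
  rw [add_sub_cancel_right]
  apply sum_norm_le (by positivity)
  intro i hi
  rw [mem_range] at hi
  rw [norm_mul]
  exact (mul_le_of_le_one_right (norm_nonneg _) (norm_nat_le_one _)).trans
    (norm_nat_le_of_dvd (choose_pow_dvd s m (i + 1) (by omega) (by omega)))

lemma choose_even (s r : ℕ) (hr : 0 < r) (hr2 : r < 2 ^ s) : 2 ^ 1 ∣ (r + (2 ^ s - 1)).choose (2 ^ s - 1) := by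
  have hs : 1 ≤ 2 ^ s := Nat.one_le_two_pow
  set X := (r + (2 ^ s - 1)).choose (2 ^ s - 1) with hX
  have h0 : X ≠ 0 := (Nat.choose_pos (by omega)).ne'
  have h1 : r * X = 2 ^ s * (r + (2 ^ s - 1)).choose (2 ^ s) := by
    have := Nat.choose_succ_right_eq (r + (2 ^ s - 1)) (2 ^ s - 1)
    rw [Nat.sub_add_cancel hs, Nat.add_sub_cancel] at this
    rw [hX]; linarith
  have h2 : 2 ^ s ∣ r * X := ⟨_, h1⟩
  rw [padicValNat_dvd_iff_le (by positivity), padicValNat.mul hr.ne' h0] at h2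
  rw [padicValNat_dvd_iff_le h0]
  have h3 : padicValNat 2 r < s := by
    by_contra hc
    push Not at hc
    have := (padicValNat_dvd_iff_le (p := 2) hr.ne').2 hc
    have := Nat.le_of_dvd hr this
    omega
  omega

lemma hh_lip (s m t : ℕ) :
    ‖hh (2 ^ s - 1) (t + 2 ^ (s + m)) - hh (2 ^ s - 1) t‖ ≤ (1 / 2) ^ (m + 1) := by
  rw [hh, hh]
  refine mul_lip (norm_nat_le_one _) (norm_prod_inv _ _).le ?_ ?_
  · rw [add_right_comm]
    exact choose_lip s m _
  · apply prod_lip _ _ _ (by positivity)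
    · intro i; rw [norm_inv, norm_odd_nat, inv_one]
    · intro i; rw [norm_inv, norm_odd_nat, inv_one]
    · intro i
      rw [add_right_comm]
      refine (inv_lip _ _).trans ?_
      push_cast
      rw [norm_two_pow]
      have : (1 / 2 : ℝ) ^ (s + m) ≤ (1 / 2) ^ m := pow_le_pow_of_le_one (by norm_num) (by norm_num) (by omega)
      rw [pow_succ]
      have : (0 : ℝ) < (1 / 2) ^ m := by positivity
      linarith

lemma sum_blocks (f : ℕ → ℚ_[2]) (B N : ℕ) :
    ∑ t ∈ range (B * N), f t = ∑ y ∈ range N, ∑ r ∈ range B, f (r + B * y) := by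
  induction N with
  | zero => simp
  | succ N ih =>
    rw [Nat.mul_succ, Finset.sum_range_add, ih, Finset.sum_range_succ]
    congr 1
    apply Finset.sum_congr rfl; intro r _; rw [add_comm]

lemma av_hh (s m : ℕ) : ‖av (s + m) (fun t => hh (2 ^ s - 1) t ^ 2)‖ = 2 ^ s := by
  have h1 : 2 ^ s * av (s + m) (fun t => hh (2 ^ s - 1) t ^ 2) =
      ∑ r ∈ range (2 ^ s), av m (fun y => hh (2 ^ s - 1) (r + 2 ^ s * y) ^ 2) := by
    simp only [av]
    rw [← Finset.sum_div, pow_add 2 s m, sum_blocks, Finset.sum_comm, pow_add]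
    field_simp
  have h2 : ∀ r, ‖av m (fun y => hh (2 ^ s - 1) (r + 2 ^ s * y) ^ 2) - hh (2 ^ s - 1) r ^ 2‖ ≤ 1 / 2 := by
    intro r
    have := av_close (fun y => hh (2 ^ s - 1) (r + 2 ^ s * y) ^ 2) (by
      intro m y
      have hl := hh_lip s m (r + 2 ^ s * y)
      rw [show r + 2 ^ s * y + 2 ^ (s + m) = r + 2 ^ s * (y + 2 ^ m) by rw [pow_add]; ring] at hl
      set a := hh (2 ^ s - 1) (r + 2 ^ s * y) with ha
      set b := hh (2 ^ s - 1) (r + 2 ^ s * (y + 2 ^ m)) with hb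
      rw [show b ^ 2 - a ^ 2 = (b - a) * (2 ^ 1 * a + (b - a)) by ring, norm_mul, pow_succ (1 / 2 : ℝ) (m + 1)]
      have : ‖2 ^ 1 * a + (b - a)‖ ≤ 1 / 2 := by
        refine (Padic.nonarchimedean _ _).trans (max_le ?_ ?_)
        · rw [norm_mul, norm_two_pow, pow_one]
          exact mul_le_of_le_one_right (by norm_num) (hh_norm_le _ _)
        · refine hl.trans ?_
          rw [pow_succ]
          have : (1 / 2 : ℝ) ^ m ≤ 1 := pow_le_one₀ (by norm_num) (by norm_num)
          linarith
      gcongr) m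
    simpa using this
  have h3 : ‖2 ^ s * av (s + m) (fun t => hh (2 ^ s - 1) t ^ 2) - hh (2 ^ s - 1) 0 ^ 2‖ ≤ 1 / 2 := by
    rw [h1]
    have hs : 2 ^ s = (2 ^ s - 1) + 1 := (Nat.sub_add_cancel Nat.one_le_two_pow).symm
    rw [show range (2 ^ s) = range ((2 ^ s - 1) + 1) by rw [← hs], Finset.sum_range_succ', add_sub_assoc]
    refine (Padic.nonarchimedean _ _).trans (max_le ?_ (h2 0))
    apply sum_norm_le (by norm_num)
    intro r hr
    rw [mem_range] at hr
    rw [← sub_add_cancel (av m _) (hh (2 ^ s - 1) (r + 1) ^ 2)]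
    refine (Padic.nonarchimedean _ _).trans (max_le (h2 _) ?_)
    rw [norm_pow, hh_norm]
    have := norm_nat_le_of_dvd (choose_even s (r + 1) (by omega) (by omega))
    rw [pow_one] at this
    have h0 := norm_nonneg (((r + 1 + (2 ^ s - 1)).choose (2 ^ s - 1) : ℕ) : ℚ_[2])
    nlinarith
  have h4 : ‖hh (2 ^ s - 1) 0 ^ 2‖ = 1 := by
    rw [norm_pow, hh_norm]; simp
  have h5 : ‖2 ^ s * av (s + m) (fun t => hh (2 ^ s - 1) t ^ 2)‖ = 1 := by
    have hlt : ‖2 ^ s * av (s + m) (fun t => hh (2 ^ s - 1) t ^ 2) - hh (2 ^ s - 1) 0 ^ 2‖ < ‖hh (2 ^ s - 1) 0 ^ 2‖ := by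
      rw [h4]; linarith
    have hmax := Padic.add_eq_max_of_ne hlt.ne
    rw [sub_add_cancel, max_eq_right hlt.le, h4] at hmax
    exact hmax
  rw [norm_mul, norm_two_pow] at h5
  rw [one_div, inv_pow] at h5
  field_simp at h5
  exact h5


lemma F_eq (n t : ℕ) : ∑ k ∈ range (n + 1), (rho n k : ℚ_[2]) / (1 + 4 * ((t + k : ℕ) : ℚ_[2])) =
    32 ^ n * n.factorial * hh n t := by
  have h := partial_fraction n t (fun k _ => by positivity)
  have h2 : ∏ i ∈ range n, ((t : ℚ) + (i + 1)) = n.factorial * (t + n).choose n := by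
    have := Nat.ascFactorial_eq_factorial_mul_choose t n
    rw [Nat.ascFactorial_eq_prod_range] at this
    rw [← Nat.cast_mul, ← this]
    push_cast
    apply Finset.prod_congr rfl; intro i _; ring
  rw [h2] at h
  have h3 := congrArg (fun x : ℚ => (x : ℚ_[2])) h
  push_cast at h3
  rw [hh, Finset.prod_inv_distrib]
  push_cast
  rw [h3]
  ring

lemma av_shift (M k : ℕ) (g : ℕ → ℚ_[2]) :
    av M (fun t => g (t + k)) = av M g + ∑ j ∈ range k, (g (j + 2 ^ M) - g j) / 2 ^ M := by
  induction k with
  | zero => simp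
  | succ k ih =>
    rw [Finset.sum_range_succ, ← add_assoc, ← ih]
    simp only [av]
    rw [← add_div]
    congr 1
    have h1 := Finset.sum_range_succ (fun t => g (t + k)) (2 ^ M)
    have h2 := Finset.sum_range_succ' (fun t => g (t + k)) (2 ^ M)
    rw [h1] at h2
    simp only [zero_add] at h2
    rw [Finset.sum_congr rfl (fun t _ => by rw [add_right_comm, add_assoc] :
      ∀ t ∈ range (2 ^ M), g (t + (k + 1)) = g (t + 1 + k))]
    rw [add_comm k (2 ^ M)]
    linear_combination -h2

lemma tendsto_two_pow : Tendsto (fun M : ℕ => (2 : ℚ_[2]) ^ M) atTop (nhds 0) := by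
  apply tendsto_pow_atTop_nhds_zero_of_norm_lt_one
  have := norm_two_pow 1
  rw [pow_one] at this
  rw [this]; norm_num

lemma lim_T (k : ℕ) : Tendsto (fun M => ∑ j ∈ range k, ((1 + 4 * ((j + 2 ^ M : ℕ) : ℚ_[2]))⁻¹ -
    (1 + 4 * (j : ℚ_[2]))⁻¹) / 2 ^ M) atTop (nhds (TT k : ℚ_[2])) := by
  rw [TT]
  push_cast
  apply tendsto_finsetSum
  intro j _
  have hj := odd_nat_ne j
  have h1 : Tendsto (fun M : ℕ => -(4 / ((1 + 4 * (j : ℚ_[2])) * (1 + 4 * ((j : ℚ_[2]) + 2 ^ M))))) atTop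
      (nhds (-(4 / ((1 + 4 * (j : ℚ_[2])) * (1 + 4 * ((j : ℚ_[2]) + 0)))))) := by
    apply Tendsto.neg
    apply Tendsto.div tendsto_const_nhds
    · exact tendsto_const_nhds.mul (tendsto_const_nhds.add (tendsto_const_nhds.mul
        (tendsto_const_nhds.add tendsto_two_pow)))
    · rw [add_zero]; exact mul_ne_zero hj hj
  rw [add_zero, ← pow_two] at h1
  refine h1.congr ?_
  intro M
  have h2 := odd_nat_ne (j + 2 ^ M)
  push_cast at h2
  field_simp
  ring

lemma lim_S (k : ℕ) : Tendsto (fun M => ∑ j ∈ range k, (((1 + 4 * ((j + 2 ^ M : ℕ) : ℚ_[2])) ^ 2)⁻¹ -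
    ((1 + 4 * (j : ℚ_[2])) ^ 2)⁻¹) / 2 ^ M) atTop (nhds (SS k : ℚ_[2])) := by
  rw [SS]
  push_cast
  apply tendsto_finsetSum
  intro j _
  have hj := odd_nat_ne j
  have h1 : Tendsto (fun M : ℕ => -((8 * (1 + 4 * (j : ℚ_[2])) + 16 * 2 ^ M) /
      ((1 + 4 * (j : ℚ_[2])) ^ 2 * (1 + 4 * ((j : ℚ_[2]) + 2 ^ M)) ^ 2))) atTop
      (nhds (-((8 * (1 + 4 * (j : ℚ_[2])) + 16 * 0) /
      ((1 + 4 * (j : ℚ_[2])) ^ 2 * (1 + 4 * ((j : ℚ_[2]) + 0)) ^ 2)))) := by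
    apply Tendsto.neg
    apply Tendsto.div
    · exact tendsto_const_nhds.add (tendsto_const_nhds.mul tendsto_two_pow)
    · exact tendsto_const_nhds.mul ((tendsto_const_nhds.add (tendsto_const_nhds.mul
        (tendsto_const_nhds.add tendsto_two_pow))).pow 2)
    · rw [add_zero]; exact mul_ne_zero (pow_ne_zero 2 hj) (pow_ne_zero 2 hj)
  have e : (-((8 * (1 + 4 * (j : ℚ_[2])) + 16 * 0) /
      ((1 + 4 * (j : ℚ_[2])) ^ 2 * (1 + 4 * ((j : ℚ_[2]) + 0)) ^ 2))) = -(8 / (1 + 4 * (j : ℚ_[2])) ^ 3) := by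
    rw [add_zero, mul_zero, add_zero]
    field_simp
  rw [e] at h1
  refine h1.congr ?_
  intro M
  have h2 := odd_nat_ne (j + 2 ^ M)
  push_cast at h2
  push_cast
  field_simp
  ring

lemma av_sum (M : ℕ) (s : Finset ℕ) (g : ℕ → ℕ → ℚ_[2]) :
    av M (fun t => ∑ k ∈ s, g k t) = ∑ k ∈ s, av M (g k) := by
  simp only [av]
  rw [Finset.sum_comm, Finset.sum_div]

lemma av_mul (M : ℕ) (c : ℚ_[2]) (g : ℕ → ℚ_[2]) : av M (fun t => c * g t) = c * av M g := by
  simp only [av]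
  rw [← Finset.mul_sum, mul_div_assoc]

lemma lim_kl (W : ℚ_[2]) (hW : Tendsto (fun M => av M (fun t => ((1 + 4 * (t : ℚ_[2])) ^ 2)⁻¹)) atTop (nhds W))
    (k l : ℕ) : Tendsto (fun M => av M (fun t => (1 + 4 * ((t + k : ℕ) : ℚ_[2]))⁻¹ * (1 + 4 * ((t + l : ℕ) : ℚ_[2]))⁻¹))
      atTop (nhds ((if k = l then W + SS k else 0) + (TT k - TT l) / (4 * ((l : ℚ_[2]) - k)))) := by
  by_cases h : k = l
  · subst h
    simp only [if_true, sub_self, zero_div, add_zero]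
    have := hW.add (lim_S k)
    refine this.congr ?_
    intro M
    rw [← av_shift M k (fun t => ((1 + 4 * (t : ℚ_[2])) ^ 2)⁻¹)]
    congr 1
    funext t
    rw [pow_two, mul_inv]
  · rw [if_neg h, zero_add]
    have hkl : (l : ℚ_[2]) - k ≠ 0 := by
      rw [sub_ne_zero]; exact_mod_cast (Ne.symm h)
    have := ((lim_T k).sub (lim_T l)).div_const (4 * ((l : ℚ_[2]) - k))
    refine this.congr ?_
    intro M
    have h1 := av_shift M k (fun t => (1 + 4 * (t : ℚ_[2]))⁻¹)
    have h2 := av_shift M l (fun t => (1 + 4 * (t : ℚ_[2]))⁻¹)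
    have h3 : av M (fun t => (1 + 4 * ((t + k : ℕ) : ℚ_[2]))⁻¹ * (1 + 4 * ((t + l : ℕ) : ℚ_[2]))⁻¹) =
        (av M (fun t => (1 + 4 * ((t + k : ℕ) : ℚ_[2]))⁻¹) - av M (fun t => (1 + 4 * ((t + l : ℕ) : ℚ_[2]))⁻¹)) /
          (4 * ((l : ℚ_[2]) - k)) := by
      simp only [av]
      rw [← sub_div, ← Finset.sum_sub_distrib, div_right_comm]
      congr 1
      rw [Finset.sum_div]
      apply Finset.sum_congr rfl
      intro t _
      have a1 := odd_nat_ne (t + k)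
      have a2 := odd_nat_ne (t + l)
      rw [eq_div_iff (by simpa using hkl)]
      field_simp
      push_cast
      ring
    rw [h3, h1, h2]
    ring

lemma lim_form (W : ℚ_[2]) (hW : Tendsto (fun M => av M (fun t => ((1 + 4 * (t : ℚ_[2])) ^ 2)⁻¹)) atTop (nhds W))
    (n : ℕ) : Tendsto (fun M => (32 ^ n * n.factorial) ^ 2 * av M (fun t => hh n t ^ 2)) atTop
      (nhds ((qq n : ℚ_[2]) * W - (pp n : ℚ_[2]))) := by
  have h1 : ∀ M, (32 ^ n * n.factorial) ^ 2 * av M (fun t => hh n t ^ 2) =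
      ∑ k ∈ range (n + 1), ∑ l ∈ range (n + 1), ((rho n k : ℚ_[2]) * rho n l) *
        av M (fun t => (1 + 4 * ((t + k : ℕ) : ℚ_[2]))⁻¹ * (1 + 4 * ((t + l : ℕ) : ℚ_[2]))⁻¹) := by
    intro M
    rw [← av_mul]
    simp only [← av_mul, ← av_sum]
    congr 1
    funext t
    rw [← mul_pow, ← F_eq, pow_two, Finset.sum_mul_sum]
    apply Finset.sum_congr rfl; intro k _
    apply Finset.sum_congr rfl; intro l _
    rw [div_eq_mul_inv, div_eq_mul_inv]; ring
  simp only [h1]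
  have h2 : (qq n : ℚ_[2]) * W - (pp n : ℚ_[2]) = ∑ k ∈ range (n + 1), ∑ l ∈ range (n + 1),
      ((rho n k : ℚ_[2]) * rho n l) * ((if k = l then W + SS k else 0) + (TT k - TT l) / (4 * ((l : ℚ_[2]) - k))) := by
    rw [pp_eq, qq]
    push_cast
    simp only [mul_add, Finset.sum_add_distrib, mul_ite, mul_zero, Finset.sum_ite_eq]
    rw [Finset.sum_congr rfl (fun k hk => if_pos hk), Finset.sum_add_distrib, Finset.sum_mul]
    ring
  rw [h2]
  exact tendsto_finsetSum _ fun k _ => tendsto_finsetSum _ fun l _ => (lim_kl W hW k l).const_mul _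

lemma val_fact (s : ℕ) : 2 ^ (2 ^ s - 1) ∣ (2 ^ s).factorial := by
  rw [padicValNat_dvd_iff_le (Nat.factorial_pos _).ne']
  have : padicValNat 2 (2 ^ s).factorial + 1 = 2 ^ s := by
    induction s with
    | zero => simp
    | succ s ih =>
      rw [pow_succ', padicValNat_factorial_mul, add_right_comm, ih]; ring
  omega

lemma norm_fact (s : ℕ) : ‖((2 ^ s - 1).factorial : ℚ_[2])‖ ≤ (1 / 2) ^ (2 ^ s - 1) * 2 ^ s := by
  have h := norm_nat_le_of_dvd (val_fact s)
  have e : (2 ^ s).factorial = 2 ^ s * (2 ^ s - 1).factorial := by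
    rw [Nat.mul_factorial_pred]; positivity
  rw [e] at h
  push_cast at h
  rw [norm_mul, norm_two_pow] at h
  have : (0 : ℝ) < 2 ^ s := by positivity
  calc _ = (1 / 2) ^ s * ‖((2 ^ s - 1).factorial : ℚ_[2])‖ * 2 ^ s := by
        rw [one_div, inv_pow]; field_simp
    _ ≤ _ := by gcongr

lemma form_norm (W : ℚ_[2]) (hW : Tendsto (fun M => av M (fun t => ((1 + 4 * (t : ℚ_[2])) ^ 2)⁻¹)) atTop (nhds W))
    (s n : ℕ) (hn : n = 2 ^ s - 1) : (qq n : ℚ_[2]) * W - (pp n : ℚ_[2]) ≠ 0 ∧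
      ‖(qq n : ℚ_[2]) * W - (pp n : ℚ_[2])‖ ≤ (1 / 4096) ^ n * ((n : ℝ) + 1) ^ 3 := by
  have h1 := (lim_form W hW n).norm
  have h2 : ‖(qq n : ℚ_[2]) * W - (pp n : ℚ_[2])‖ = ‖((32 : ℚ_[2]) ^ n * n.factorial) ^ 2‖ * 2 ^ s := by
    refine tendsto_nhds_unique h1 ?_
    refine tendsto_const_nhds.congr' ?_
    filter_upwards [eventually_ge_atTop s] with M hM
    obtain ⟨m, rfl⟩ := Nat.exists_eq_add_of_le hM
    rw [norm_mul, hn, av_hh]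
  have hns : ((n : ℝ) + 1) = 2 ^ s := by
    rw [hn, Nat.cast_sub Nat.one_le_two_pow]; push_cast; ring
  constructor
  · rw [← norm_ne_zero_iff, h2]
    have : ((32 : ℚ_[2]) ^ n * n.factorial) ^ 2 ≠ 0 := by
      have : (n.factorial : ℚ_[2]) ≠ 0 := by exact_mod_cast (Nat.factorial_pos n).ne'
      exact pow_ne_zero 2 (mul_ne_zero (pow_ne_zero n (by norm_num)) this)
    exact mul_ne_zero (norm_ne_zero_iff.2 this) (by positivity)
  · rw [h2, hns, norm_pow, norm_mul, norm_pow, show (32 : ℚ_[2]) = 2 ^ 5 by norm_num, norm_two_pow]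
    have hf := norm_fact s
    rw [← hn] at hf
    calc _ ≤ (((1 / 2 : ℝ) ^ 5) ^ n * ((1 / 2) ^ n * 2 ^ s)) ^ 2 * 2 ^ s := by gcongr
      _ = ((((1 / 2 : ℝ) ^ 5) * (1 / 2)) ^ 2) ^ n * (2 ^ s) ^ 3 := by
        rw [← pow_mul (((1 / 2 : ℝ) ^ 5) * (1 / 2)) 2 n, mul_comm 2 n,
          pow_mul (((1 / 2 : ℝ) ^ 5) * (1 / 2)) n 2, mul_pow ((1 / 2 : ℝ) ^ 5) (1 / 2) n]; ring
      _ = _ := by norm_num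

lemma int_lower (N : ℤ) (hN : N ≠ 0) : 1 ≤ |(N : ℝ)| * ‖(N : ℚ_[2])‖ := by
  have h0 : (N : ℚ_[2]) ≠ 0 := by exact_mod_cast hN
  set v := padicValInt 2 N
  have h1 : ‖(N : ℚ_[2])‖ = ((2 : ℝ) ^ v)⁻¹ := by
    rw [Padic.norm_eq_zpow_neg_valuation h0, Padic.valuation_intCast]
    simp [v, zpow_neg]
  have h2 : (2 : ℤ) ^ v ∣ N := by
    have := padicValInt_dvd (p := 2) N
    exact_mod_cast this
  have h3 : (2 : ℤ) ^ v ≤ |N| := Int.le_of_dvd (abs_pos.2 hN) ((dvd_abs _ _).2 h2)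
  have h4 : (2 : ℝ) ^ v ≤ |(N : ℝ)| := by exact_mod_cast h3
  rw [h1, ← div_eq_mul_inv, one_le_div (by positivity)]
  exact h4

lemma W_irrational (W : ℚ_[2])
    (hW : Tendsto (fun M => av M (fun t => ((1 + 4 * (t : ℚ_[2])) ^ 2)⁻¹)) atTop (nhds W)) (w : ℚ) :
    W ≠ (w : ℚ_[2]) := by
  intro hw
  obtain ⟨C, hC, hd⟩ := dn_le
  set a : ℤ := w.num with ha
  set b : ℕ := w.den with hb
  have hb0 : (b : ℚ) ≠ 0 := by exact_mod_cast w.den_nz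
  have hwab : w * b = a := Rat.mul_den_eq_num w
  set K : ℝ := C ^ 3 * 2 * (|(a : ℝ)| + b) with hK
  have hbound : ∀ s : ℕ, 1 ≤ s → 1 ≤ K * ((((2 ^ s : ℕ) : ℝ)) ^ 6 * (59319 / 64000 : ℝ) ^ (2 ^ s - 1)) := by
    intro s hs
    obtain ⟨n, hn⟩ : ∃ n, n = 2 ^ s - 1 := ⟨_, rfl⟩
    have h2s : 2 ≤ 2 ^ s := by
      calc 2 = 2 ^ 1 := rfl
        _ ≤ 2 ^ s := Nat.pow_le_pow_right (by norm_num) hs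
    have hn1 : 1 ≤ n := by omega
    have hns : ((2 ^ s : ℕ) : ℝ) = (n : ℝ) + 1 := by
      rw [show 2 ^ s = n + 1 by omega]; push_cast; ring
    rw [hns, ← hn]
    obtain ⟨hne, hle⟩ := form_norm W hW s n hn
    obtain ⟨P, hP⟩ := pp_int n
    obtain ⟨Q, hQ⟩ := qq_int n hn1
    have hNq : ((Q * a - P * b : ℤ) : ℚ) = (dn n : ℚ) ^ 3 * b * (qq n * w - pp n) := by
      push_cast
      rw [← hP, ← hQ, ← hwab]; ring
    have hNp : ((Q * a - P * b : ℤ) : ℚ_[2]) = (dn n : ℚ_[2]) ^ 3 * b * (qq n * W - pp n) := by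
      have := congrArg (fun x : ℚ => (x : ℚ_[2])) hNq
      rw [hw]
      push_cast at this ⊢
      exact this
    set N : ℤ := Q * a - P * b with hN
    have hdn : (dn n : ℚ_[2]) ≠ 0 := by exact_mod_cast (dn_pos n).ne'
    have hbp : (b : ℚ_[2]) ≠ 0 := by exact_mod_cast w.den_nz
    have hN0 : N ≠ 0 := by
      intro h
      rw [h, Int.cast_zero] at hNp
      exact mul_ne_zero (mul_ne_zero (pow_ne_zero 3 hdn) hbp) hne hNp.symm
    have hnorm : ‖(N : ℚ_[2])‖ ≤ (1 / 4096) ^ n * ((n : ℝ) + 1) ^ 3 := by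
      rw [hNp, norm_mul]
      refine (mul_le_of_le_one_left (norm_nonneg _) ?_).trans hle
      have := norm_nat_le_one (dn n ^ 3 * b)
      push_cast at this; exact this
    have habs : |(N : ℝ)| ≤ (C * (39 / 10) ^ n) ^ 3 * (2 * ((n : ℝ) + 1) ^ 3 * 64 ^ n * (|(a : ℝ)| + b)) := by
      have e1 : (N : ℝ) = (dn n : ℝ) ^ 3 * ((qq n : ℝ) * a - (pp n : ℝ) * b) := by
        have h : (N : ℚ) = (dn n : ℚ) ^ 3 * (qq n * a - pp n * b) := by
          rw [hNq, ← hwab]; ring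
        exact_mod_cast congrArg (fun x : ℚ => (x : ℝ)) h
      have hq : |(qq n : ℝ)| ≤ ((n : ℝ) + 1) * 64 ^ n := by exact_mod_cast qq_abs n
      have hp : |(pp n : ℝ)| ≤ 2 * ((n : ℝ) + 1) ^ 3 * 64 ^ n := by exact_mod_cast pp_abs n
      have hq' : |(qq n : ℝ)| ≤ 2 * ((n : ℝ) + 1) ^ 3 * 64 ^ n := by
        refine hq.trans ?_
        have h1 : (0 : ℝ) ≤ n := by positivity
        gcongr
        nlinarith [pow_nonneg h1 2, pow_nonneg h1 3]
      rw [e1, abs_mul, abs_of_nonneg (by positivity : (0 : ℝ) ≤ (dn n : ℝ) ^ 3)]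
      have e2 : |(qq n : ℝ) * a - (pp n : ℝ) * b| ≤ 2 * ((n : ℝ) + 1) ^ 3 * 64 ^ n * (|(a : ℝ)| + b) := by
        refine (abs_sub _ _).trans ?_
        rw [abs_mul, abs_mul, mul_add, abs_of_nonneg (by positivity : (0 : ℝ) ≤ (b : ℝ))]
        gcongr
      have := hd n
      gcongr
    have h1 := int_lower N hN0
    calc (1 : ℝ) ≤ |(N : ℝ)| * ‖(N : ℚ_[2])‖ := h1
      _ ≤ ((C * (39 / 10) ^ n) ^ 3 * (2 * ((n : ℝ) + 1) ^ 3 * 64 ^ n * (|(a : ℝ)| + b))) *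
          ((1 / 4096) ^ n * ((n : ℝ) + 1) ^ 3) := by gcongr
      _ = K * (((n : ℝ) + 1) ^ 6 * (((39 / 10) ^ 3 * 64 * (1 / 4096)) ^ n)) := by
        rw [hK, mul_pow _ _ n, mul_pow _ _ n, ← pow_mul, mul_comm 3 n, pow_mul, mul_pow]; ring
      _ = _ := by norm_num
  have ht : Tendsto (fun n : ℕ => K * (64000 / 59319) * ((n : ℝ) ^ 6 * (59319 / 64000 : ℝ) ^ n)) atTop (nhds 0) := by
    have := (tendsto_pow_const_mul_const_pow_of_abs_lt_one 6 (r := (59319 / 64000 : ℝ))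
      (by rw [abs_of_pos (by norm_num)]; norm_num)).const_mul (K * (64000 / 59319))
    simpa using this
  obtain ⟨n0, hn0⟩ := eventually_atTop.1 (ht.eventually (gt_mem_nhds (zero_lt_one)))
  have h1 := hn0 (2 ^ (n0 + 1)) ((Nat.lt_two_pow_self (n := n0)).le.trans
    (Nat.pow_le_pow_right (by norm_num) (by omega)))
  have h2 := hbound (n0 + 1) (by omega)
  have e : (59319 / 64000 : ℝ) ^ (2 ^ (n0 + 1)) = (59319 / 64000 : ℝ) ^ (2 ^ (n0 + 1) - 1) * (59319 / 64000) := by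
    rw [← pow_succ, Nat.sub_add_cancel Nat.one_le_two_pow]
  rw [e] at h1
  nlinarith

theorem irrational_zeta2Quarter_three :
    ∃ z : ℚ_[2], zeta2Quarter 3 z ∧ ∀ q : ℚ, z ≠ (q : ℚ_[2]) := by
  obtain ⟨W, hW⟩ := exists_W
  refine ⟨W / 2, ?_, ?_⟩
  · rw [zeta2Quarter]
    have h := hW.const_mul 16
    rw [show (((3 : ℕ) : ℚ_[2]) - 1) * 4 ^ (3 - 1) * (W / 2) = 16 * W by push_cast; ring]
    refine h.congr ?_
    intro M
    rw [av, div_eq_inv_mul, mul_left_comm, Finset.mul_sum]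
    congr 1
    apply Finset.sum_congr rfl
    intro t _
    rw [show (1 : ℤ) - ((3 : ℕ) : ℤ) = -((2 : ℕ) : ℤ) by norm_num, zpow_neg, zpow_natCast]
    push_cast
    rw [show (t : ℚ_[2]) + 1 / 4 = (1 + 4 * t) / 4 by ring, div_pow, inv_div, div_eq_mul_inv]
    norm_num
  · intro q hq
    apply W_irrational W hW (2 * q)
    push_cast
    rw [← hq]; ring
end

section
/- Fix a nonnegative integer s and δ ∈ {0,1}, and let n be a positive integer. Let a_{n,i,k} (1 ≤ i ≤ 2s+4, 0 ≤ k ≤ n) be the unique rational numbers such that A_n(t) = ∑_{i=1}^{2s+4} ∑_{k=0}^{n} a_{n,i,k}/(t+k)^i holds for every rational number t ∉ {0,−1,…,−n}, and let b_{n,i,k} (1 ≤ i ≤ s+2, 0 ≤ k ≤ n) be the unique rational numbers such that B_n(t) = ∑_{i=1}^{s+2} ∑_{k=0}^{n} b_{n,i,k}/(t+k)^i for every rational t ∉ {0,−1,…,−n}. Then d_n^{2s+4−i} · a_{n,i,k} ∈ ℤ for all 1 ≤ i ≤ 2s+4 and 0 ≤ k ≤ n, and d_n^{s+2−i} · b_{n,i,k}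 ∈ ℤ for all 1 ≤ i ≤ s+2 and 0 ≤ k ≤ n. -/
open Filter Finset

/-- Pochhammer symbol `(α)_k = α (α+1) ⋯ (α+k-1)` for rational `α`. -/
def poch (α : ℚ) (k : ℕ) : ℚ := ∏ i ∈ Finset.range k, (α + i)

/-- The rational function
`A_n(t) = 2^{(6s+12)n} (4t+2n)^δ (t+1/4)_n^{s+2} (t+3/4)_n^{s+2} / (t)_{n+1}^{2s+4}`. -/
def Afun (s δ n : ℕ) (t : ℚ) : ℚ :=
  2 ^ ((6 * s + 12) * n) * (4 * t + 2 * n) ^ δ *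
    poch (t + 1/4) n ^ (s + 2) * poch (t + 3/4) n ^ (s + 2) / poch t (n + 1) ^ (2 * s + 4)

/-- The rational function `B_n(t) = 2^{(3s+6)n} (t+3/4)_n^{s+2} / (t)_{n+1}^{s+2}`. -/
def Bfun (s n : ℕ) (t : ℚ) : ℚ :=
  2 ^ ((3 * s + 6) * n) * poch (t + 3/4) n ^ (s + 2) / poch t (n + 1) ^ (s + 2)

/-- `dlcm n = lcm(1, 2, …, n)`. -/
def dlcm (n : ℕ) : ℕ := (Finset.Icc 1 n).lcm id

open scoped Classical in
/-- `Phi n` is the product of all primes `q` with `√(10 n) < q ≤ n` and `{n/q} > 1/2`. -/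
noncomputable def Phi (n : ℕ) : ℕ :=
  ∏ q ∈ Finset.Icc 1 n,
    if q.Prime ∧ Real.sqrt (10 * n) < (q : ℝ) ∧ 1/2 < Int.fract ((n : ℝ) / q) then q else 1


open Polynomial Asymptotics Topology

/-- `n!` divides `2^n ∏ (c+4i)`. -/
lemma fact_dvd_aux (n : ℕ) (c : ℤ) :
    (n.factorial : ℤ) ∣ 2 ^ n * ∏ i ∈ Finset.range n, (c + 4 * i) := by
  obtain ⟨e, m, hm, hem⟩ := Nat.exists_eq_two_pow_mul_odd (Nat.factorial_ne_zero n)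
  have he : e ≤ n := by
    have : Fact (Nat.Prime 2) := ⟨Nat.prime_two⟩
    have h1 := sub_one_mul_padicValNat_factorial (p := 2) n
    have h2 : e ≤ padicValNat 2 n.factorial :=
      (padicValNat_dvd_iff_le (Nat.factorial_ne_zero n)).1 ⟨m, hem⟩
    omega
  have hco : IsCoprime (m : ℤ) (4 : ℤ) := by
    have : Nat.Coprime m 4 := by
      have h := (Nat.coprime_two_right.2 hm).pow_right 2
      simpa using h
    exact_mod_cast (Nat.isCoprime_iff_coprime.2 this)
  have hmd : (m : ℤ) ∣ ∏ i ∈ Finset.range n, (c + 4 * (i : ℤ)) := by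
    obtain ⟨u, w, huw⟩ := hco
    have h3 : (m : ℤ) ∣ ∏ i ∈ Finset.range n, (w * c + (i : ℤ)) :=
      dvd_trans ⟨2 ^ e, by rw [hem]; push_cast; ring⟩ (Nat.factorial_coe_dvd_prod n (w * c))
    have h4 : (∏ i ∈ Finset.range n, (c + 4 * (i : ℤ))) ≡
        ∏ i ∈ Finset.range n, (4 * (w * c + (i : ℤ))) [ZMOD m] := by
      apply Int.ModEq.prod
      intro i _
      apply Int.modEq_iff_dvd.2
      refine ⟨-u * c, ?_⟩
      linear_combination (c) * huw
    rw [Finset.prod_mul_distrib] at h4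
    have h5 := (Int.modEq_zero_iff_dvd.2 (h3.mul_left (∏ i ∈ Finset.range n, (4 : ℤ))))
    exact Int.modEq_zero_iff_dvd.1 (h4.trans h5)
  rw [hem]
  push_cast
  exact mul_dvd_mul (pow_dvd_pow _ he) hmd

lemma prod_erase_aux (k m : ℕ) :
    ∏ j ∈ (Finset.range (k + m + 1)).erase k, ((j : ℤ) - k)
      = (-1) ^ k * k.factorial * m.factorial := by
  induction m with
  | zero =>
    have : (Finset.range (k + 0 + 1)).erase k = Finset.range k := by
      ext x; simp; omega
    rw [this]
    rw [← Finset.prod_range_reflect]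
    have : ∀ j ∈ Finset.range k, (((k - 1 - j : ℕ) : ℤ) - k) = (-1) * ((j : ℤ) + 1) := by
      intro j hj
      have := Finset.mem_range.1 hj
      omega
    rw [Finset.prod_congr rfl this, Finset.prod_mul_distrib]
    simp only [Finset.prod_const, Finset.card_range, Nat.factorial_zero, Nat.cast_one, mul_one]
    rw [← Finset.prod_range_add_one_eq_factorial]
    push_cast
    rfl
  | succ m ih =>
    have : (Finset.range (k + (m + 1) + 1)).erase k
        = insert (k + m + 1) ((Finset.range (k + m + 1)).erase k) := by
      ext x; simp; omega
    rw [this, Finset.prod_insert (by simp), ih, Nat.factorial_succ]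
    push_cast
    ring

/-- Simple building block. -/
def Ffun (c : ℤ) (n : ℕ) (t : ℚ) : ℚ := 8 ^ n * poch (t + c / 4) n / poch t (n + 1)

lemma Ffun_expand (c : ℤ) (n : ℕ) : ∃ g : ℕ → ℤ, ∀ t : ℚ, (∀ k : ℕ, k ≤ n → t + (k : ℚ) ≠ 0) →
    Ffun c n t = ∑ k ∈ Finset.range (n + 1), (g k : ℚ) / (t + k) := by
  classical
  set P : ℚ[X] := C (8 ^ n) * ∏ i ∈ Finset.range n, (X + C ((c : ℚ) / 4 + i)) with hP
  set v : ℕ → ℚ := fun j => -(j : ℚ) with hv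
  have hPe : ∀ t, P.eval t = 8 ^ n * poch (t + c / 4) n := by
    intro t
    simp [hP, poch, Polynomial.eval_prod, add_assoc]
  have hdeg : P.degree < ((Finset.range (n + 1)).card : WithBot ℕ) := by
    rw [Finset.card_range]
    refine lt_of_le_of_lt Polynomial.degree_le_natDegree ?_
    have : P.natDegree ≤ n := by
      refine (Polynomial.natDegree_C_mul_le _ _).trans ((Polynomial.natDegree_prod_le _ _).trans ?_)
      refine (Finset.sum_le_sum (fun i _ => (Polynomial.natDegree_X_add_C _).le)).trans ?_
      simp
    exact_mod_cast Nat.lt_succ_of_le this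
  have hinj : Set.InjOn v (Finset.range (n + 1) : Finset ℕ) := by
    intro x _ y _ h
    simpa [hv] using h
  have hInteger : ∀ k ≤ n, ∃ z : ℤ,
      Lagrange.nodalWeight (Finset.range (n + 1)) v k * P.eval (v k) = z := by
    intro k hk
    obtain ⟨m, rfl⟩ := Nat.exists_eq_add_of_le hk
    have h1 : Lagrange.nodalWeight (Finset.range (k + m + 1)) v k
        = (((-1) ^ k * k.factorial * m.factorial : ℤ) : ℚ)⁻¹ := by
      rw [← prod_erase_aux, Lagrange.nodalWeight, Finset.prod_inv_distrib]
      push_cast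
      congr 1
      apply Finset.prod_congr rfl
      intro j _
      simp [hv]; ring
    have h2 : P.eval (v k) = ((2 ^ (k + m) * ∏ i ∈ Finset.range (k + m), ((c - 4 * k) + 4 * (i : ℤ)) : ℤ) : ℚ) := by
      rw [hPe]
      have h8 : (8 : ℚ) ^ (k + m) = 2 ^ (k + m) * ∏ i ∈ Finset.range (k + m), 4 := by
        rw [Finset.prod_const, Finset.card_range, ← mul_pow]; norm_num
      rw [h8, poch, mul_assoc, ← Finset.prod_mul_distrib]
      push_cast
      congr 1
      apply Finset.prod_congr rfl
      intro j _
      simp only [hv]; ring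
    have h3 : ((-1) ^ k * k.factorial * m.factorial : ℤ) ∣ 2 ^ (k + m) * ∏ i ∈ Finset.range (k + m), ((c - 4 * k) + 4 * (i : ℤ)) := by
      refine dvd_trans ?_ (fact_dvd_aux (k + m) (c - 4 * k))
      rw [mul_assoc]
      have hu : IsUnit ((-1 : ℤ) ^ k) := (isUnit_one.neg).pow k
      rw [hu.mul_left_dvd]
      exact_mod_cast Nat.factorial_mul_factorial_dvd_factorial_add k m
    obtain ⟨z, hz⟩ := h3
    refine ⟨z, ?_⟩
    rw [h1, h2, hz]
    have hne : (((-1) ^ k * k.factorial * m.factorial : ℤ) : ℚ) ≠ 0 := by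
      push_cast
      have := Nat.factorial_ne_zero k
      have := Nat.factorial_ne_zero m
      positivity
    rw [Int.cast_mul (_ * _ * _) z, inv_mul_cancel_left₀ hne]
  choose! g hg using hInteger
  refine ⟨g, fun t ht => ?_⟩
  have ht' : ∀ i ∈ Finset.range (n + 1), t ≠ v i := by
    intro i hi h
    apply ht i (by simpa [Nat.lt_succ_iff] using hi)
    rw [h]; simp [hv]
  have key := Lagrange.eval_interpolate_not_at_node (fun i => P.eval (v i)) ht'
  rw [← Lagrange.eq_interpolate hinj hdeg, hPe, Lagrange.eval_nodal] at key
  have hpo : ∏ i ∈ Finset.range (n + 1), (t - v i) = poch t (n + 1) := by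
    simp [poch, hv]
  have hpne : poch t (n + 1) ≠ 0 := by
    rw [poch, Finset.prod_ne_zero_iff]
    intro i hi
    exact ht i (by simpa [Nat.lt_succ_iff] using hi)
  rw [hpo] at key
  rw [Ffun, key, mul_div_cancel_left₀ _ hpne]
  apply Finset.sum_congr rfl
  intro i hi
  rw [← hg i (by simpa [Nat.lt_succ_iff] using hi)]
  simp only [hv, sub_neg_eq_add]
  ring

/-- `f` has an integral Taylor expansion to order `M` at `0`. -/
def Good (M : ℕ) (f : ℚ → ℚ) : Prop :=
  ∃ p : ℤ[X], (fun v => f v - aeval v p) =O[𝓝[≠] (0 : ℚ)] fun v => v ^ M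

lemma poly_bdd (p : ℤ[X]) : (fun v : ℚ => aeval v p) =O[𝓝[≠] (0 : ℚ)] fun _ => (1 : ℚ) := by
  have : Continuous (fun v : ℚ => aeval v p) := Polynomial.continuous_aeval p
  exact ((this.tendsto 0).mono_left nhdsWithin_le_nhds).isBigO_one ℚ

lemma pow_bdd (M : ℕ) : (fun v : ℚ => v ^ M) =O[𝓝[≠] (0 : ℚ)] fun _ => (1 : ℚ) := by
  have : Continuous (fun v : ℚ => v ^ M) := by fun_prop
  exact ((this.tendsto 0).mono_left nhdsWithin_le_nhds).isBigO_one ℚ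

lemma Good.congr {M : ℕ} {f g : ℚ → ℚ} (hf : Good M f) (h : f =ᶠ[𝓝[≠] (0 : ℚ)] g) : Good M g := by
  obtain ⟨p, hp⟩ := hf
  refine ⟨p, hp.congr' ?_ EventuallyEq.rfl⟩
  filter_upwards [h] with v hv
  rw [hv]

lemma Good.poly (M : ℕ) (p : ℤ[X]) : Good M (fun v => aeval v p) :=
  ⟨p, by simpa using isBigO_zero _ _⟩

lemma Good.const (M : ℕ) (z : ℤ) : Good M (fun _ => (z : ℚ)) := by
  simpa using Good.poly M (C z)

lemma Good.id (M : ℕ) : Good M (fun v => v) := by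
  simpa using Good.poly M X

lemma Good.add {M : ℕ} {f g : ℚ → ℚ} (hf : Good M f) (hg : Good M g) :
    Good M (fun v => f v + g v) := by
  obtain ⟨p, hp⟩ := hf
  obtain ⟨q, hq⟩ := hg
  refine ⟨p + q, (hp.add hq).congr_left ?_⟩
  intro v
  simp only [map_add]; ring

lemma Good.mul {M : ℕ} {f g : ℚ → ℚ} (hf : Good M f) (hg : Good M g) :
    Good M (fun v => f v * g v) := by
  obtain ⟨p, hp⟩ := hf
  obtain ⟨q, hq⟩ := hg
  have hgb : g =O[𝓝[≠] (0 : ℚ)] fun _ => (1 : ℚ) :=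
    ((hq.trans (pow_bdd M)).add (poly_bdd q)).congr_left (by intro v; ring)
  refine ⟨p * q, ?_⟩
  have h1 := hp.mul hgb
  have h2 := (poly_bdd p).mul hq
  simp only [mul_one, one_mul] at h1 h2
  refine (h1.add h2).congr_left ?_
  intro v
  simp only [map_mul]; ring

lemma Good.pow {M : ℕ} {f : ℚ → ℚ} (hf : Good M f) (r : ℕ) : Good M (fun v => f v ^ r) := by
  induction r with
  | zero => simpa using Good.const M 1
  | succ r ih => simpa [pow_succ] using ih.mul hf

lemma Good.sum {M : ℕ} {ι : Type*} (s : Finset ι) {f : ι → ℚ → ℚ} (hf : ∀ i ∈ s, Good M (f i)) :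
    Good M (fun v => ∑ i ∈ s, f i v) := by
  classical
  induction s using Finset.induction_on with
  | empty => simpa using Good.const M 0
  | insert a s ha ih =>
    simp only [Finset.sum_insert ha]
    exact (hf a (by simp)).add (ih fun i hi => hf i (by simp [hi]))

lemma ev_ne {f : ℚ → ℚ} (hc : Continuous f) (h0 : f 0 ≠ 0) : ∀ᶠ v in 𝓝[≠] (0 : ℚ), f v ≠ 0 :=
  nhdsWithin_le_nhds (hc.continuousAt.eventually_ne h0)

lemma Good.geom (M : ℕ) (c : ℤ) : Good M (fun v => (1 + c * v)⁻¹) := by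
  refine ⟨∑ m ∈ Finset.range M, (C (-c) * X) ^ m, ?_⟩
  have hc : Continuous (fun v : ℚ => 1 + c * v) := by fun_prop
  have hne := ev_ne hc (by simp)
  have hb : (fun v : ℚ => (-(c : ℚ)) ^ M * (1 + c * v)⁻¹) =O[𝓝[≠] (0 : ℚ)] fun _ => (1 : ℚ) := by
    have h1 : Tendsto (fun v : ℚ => (1 + c * v)⁻¹) (𝓝 0) (𝓝 ((1 + c * (0 : ℚ))⁻¹)) :=
      (hc.tendsto 0).inv₀ (by simp)
    exact ((h1.mono_left nhdsWithin_le_nhds).const_mul _).isBigO_one ℚ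
  have h2 := hb.mul (isBigO_refl (fun v : ℚ => v ^ M) (𝓝[≠] (0 : ℚ)))
  simp only [one_mul] at h2
  refine h2.congr' ?_ EventuallyEq.rfl
  filter_upwards [hne] with v hv
  have h3 := mul_neg_geom_sum (-(c : ℚ) * v) M
  have h4 : aeval v (∑ m ∈ Finset.range M, (C (-c) * X) ^ m : ℤ[X])
      = ∑ m ∈ Finset.range M, (-(c : ℚ) * v) ^ m := by
    simp
  rw [h4]
  have h5 : (1 - -(c : ℚ) * v) = 1 + c * v := by ring
  rw [h5] at h3
  have h6 : ∑ m ∈ Finset.range M, (-(c : ℚ) * v) ^ m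
      = (1 - (-(c : ℚ) * v) ^ M) * (1 + c * v)⁻¹ := by
    rw [← h3]; field_simp
  rw [h6, mul_pow]; ring

lemma poly_unique (M : ℕ) (q : ℚ[X])
    (h : (fun v => q.eval v) =O[𝓝[≠] (0 : ℚ)] fun v => v ^ M) : ∀ m < M, q.coeff m = 0 := by
  intro m
  induction m using Nat.strong_induction_on with
  | _ m ih =>
    intro hm
    obtain ⟨r, hr⟩ := Polynomial.X_pow_dvd_iff.2 (fun d hd => ih d hd (hd.trans hm))
    have h0 : q.coeff m = r.eval 0 := by
      rw [hr, mul_comm, Polynomial.coeff_mul_X_pow', if_pos le_rfl, Nat.sub_self,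
        Polynomial.coeff_zero_eq_eval_zero]
    rw [h0]
    have h1 := h.mul (isBigO_refl (fun v : ℚ => (v ^ m)⁻¹) (𝓝[≠] (0 : ℚ)))
    have h2 : (fun v => r.eval v) =O[𝓝[≠] (0 : ℚ)] fun v => v ^ (M - m) := by
      refine h1.congr' ?_ ?_
      · filter_upwards [self_mem_nhdsWithin] with v hv
        have hv : v ≠ 0 := hv
        rw [hr]; simp; field_simp
      · filter_upwards [self_mem_nhdsWithin] with v hv
        have hv : v ≠ 0 := hv
        rw [← Nat.sub_add_cancel hm.le, pow_add]; simp; field_simp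
    have h3 : Tendsto (fun v : ℚ => v ^ (M - m)) (𝓝[≠] 0) (𝓝 0) := by
      have : Continuous (fun v : ℚ => v ^ (M - m)) := by fun_prop
      have h := (this.tendsto 0).mono_left (nhdsWithin_le_nhds (s := {0}ᶜ))
      rwa [zero_pow (by omega)] at h
    have h4 := h2.trans_tendsto h3
    have h5 := (r.continuous.tendsto 0).mono_left (nhdsWithin_le_nhds (s := {(0 : ℚ)}ᶜ))
    exact tendsto_nhds_unique h5 h4

lemma ev_nonpole (n k d : ℕ) (hd : d ≠ 0) :
    ∀ᶠ v in 𝓝[≠] (0 : ℚ), ∀ j : ℕ, j ≤ n → (d * v - k : ℚ) + (j : ℚ) ≠ 0 := by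
  have : ∀ j ∈ Finset.range (n + 1), ∀ᶠ v in 𝓝[≠] (0 : ℚ), (d * v - k : ℚ) + (j : ℚ) ≠ 0 := by
    intro j _
    by_cases hj : j = k
    · subst hj
      filter_upwards [self_mem_nhdsWithin] with v hv
      have hv : v ≠ 0 := hv
      have hd' : (d : ℚ) ≠ 0 := by exact_mod_cast hd
      simpa using ⟨hd, hv⟩
    · apply ev_ne (f := fun v : ℚ => (d * v - k : ℚ) + (j : ℚ)) (by fun_prop)
      have : (j : ℚ) ≠ k := by exact_mod_cast hj
      intro h
      apply this
      linarith
  have h := (Filter.eventually_all_finset (Finset.range (n + 1))).2 this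
  filter_upwards [h] with v hv j hj
  exact hv j (by simpa [Nat.lt_succ_iff] using hj)

lemma coeff_integral (M n d k : ℕ) (hd : d ≠ 0) (hk : k ≤ n) (a : ℕ → ℕ → ℚ) (f : ℚ → ℚ)
    (hf : ∀ t : ℚ, (∀ k : ℕ, k ≤ n → t + (k : ℚ) ≠ 0) →
      f t = ∑ i ∈ Finset.Icc 1 M, ∑ k ∈ Finset.range (n + 1), a i k / (t + (k : ℚ)) ^ i)
    (hG : Good M (fun v => (d * v) ^ M * f (d * v - k))) (i : ℕ) (hi : 1 ≤ i) (hiM : i ≤ M) :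
    ∃ z : ℤ, (d : ℚ) ^ (M - i) * a i k = z := by
  obtain ⟨p, hp⟩ := hG
  have hd' : (d : ℚ) ≠ 0 := by exact_mod_cast hd
  set Q : ℚ[X] := ∑ i ∈ Finset.Icc 1 M, C ((d : ℚ) ^ (M - i) * a i k) * X ^ (M - i) with hQ
  -- the regular part
  set R : ℚ → ℚ := fun v => ∑ i ∈ Finset.Icc 1 M, ∑ j ∈ (Finset.range (n + 1)).erase k,
    a i j * (((d : ℚ) * v - k + j) ^ i)⁻¹ with hR
  have hRb : R =O[𝓝[≠] (0 : ℚ)] fun _ => (1 : ℚ) := by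
    apply IsBigO.fun_sum
    intro i _
    apply IsBigO.fun_sum
    intro j hj
    have hc : Continuous (fun v : ℚ => ((d : ℚ) * v - k + j) ^ i) := by fun_prop
    have hjk : (j : ℚ) ≠ k := by exact_mod_cast (Finset.mem_erase.1 hj).1
    have h0 : ((d : ℚ) * 0 - k + j) ^ i ≠ 0 := by
      apply pow_ne_zero
      intro h
      apply hjk
      linarith
    have h1 : Tendsto (fun v : ℚ => (((d : ℚ) * v - k + j) ^ i)⁻¹) (𝓝 0)
        (𝓝 (((d : ℚ) * 0 - k + j) ^ i)⁻¹) := (hc.tendsto 0).inv₀ h0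
    exact ((h1.mono_left nhdsWithin_le_nhds).const_mul _).isBigO_one ℚ
  have hRM : (fun v : ℚ => ((d : ℚ) * v) ^ M * R v) =O[𝓝[≠] (0 : ℚ)] fun v => v ^ M := by
    have h1 : (fun v : ℚ => ((d : ℚ) * v) ^ M) =O[𝓝[≠] (0 : ℚ)] fun v => v ^ M := by
      simp only [mul_pow]
      exact (isBigO_refl _ _).const_mul_left _
    simpa using h1.mul hRb
  have hdec : ∀ᶠ v in 𝓝[≠] (0 : ℚ), (d * v) ^ M * f (d * v - k)
      = Q.eval v + (d * v) ^ M * R v := by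
    filter_upwards [ev_nonpole n k d hd, self_mem_nhdsWithin] with v hv hv0
    have hv0 : v ≠ 0 := hv0
    rw [hf _ hv]
    have hkm : k ∈ Finset.range (n + 1) := by simp; omega
    have : ∀ i ∈ Finset.Icc 1 M, ∑ j ∈ Finset.range (n + 1), a i j / ((d : ℚ) * v - k + j) ^ i
        = a i k / (d * v) ^ i + ∑ j ∈ (Finset.range (n + 1)).erase k,
          a i j * (((d : ℚ) * v - k + j) ^ i)⁻¹ := by
      intro i _
      rw [← Finset.add_sum_erase _ _ hkm]
      simp [div_eq_mul_inv]
    rw [Finset.sum_congr rfl this, Finset.sum_add_distrib, mul_add, hR, hQ,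
      Polynomial.eval_finsetSum, Finset.mul_sum]
    congr 1
    apply Finset.sum_congr rfl
    intro i hi
    have hi := Finset.mem_Icc.1 hi
    have hdv : (d : ℚ) * v ≠ 0 := mul_ne_zero hd' hv0
    have : ((d : ℚ) * v) ^ M = (d * v) ^ (M - i) * (d * v) ^ i := by
      rw [← pow_add, Nat.sub_add_cancel hi.2]
    rw [this]
    simp only [eval_mul, eval_C, eval_pow, eval_X]
    rw [mul_assoc, mul_div_cancel₀ _ (pow_ne_zero i hdv), mul_pow]
    ring
  have hfin : (fun v => (Q - p.map (Int.castRingHom ℚ)).eval v) =O[𝓝[≠] (0 : ℚ)]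
      fun v => v ^ M := by
    refine (hp.sub hRM).congr' ?_ EventuallyEq.rfl
    filter_upwards [hdec] with v hv
    rw [hv, Polynomial.eval_sub, Polynomial.eval_map, Polynomial.aeval_def]
    have : algebraMap ℤ ℚ = Int.castRingHom ℚ := rfl
    rw [this]
    ring
  have hc := poly_unique M _ hfin (M - i) (by omega)
  refine ⟨p.coeff (M - i), ?_⟩
  rw [Polynomial.coeff_sub, sub_eq_zero, Polynomial.coeff_map] at hc
  have hQc : Q.coeff (M - i) = (d : ℚ) ^ (M - i) * a i k := by
    rw [hQ, Polynomial.finsetSum_coeff, Finset.sum_eq_single i]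
    · rw [Polynomial.coeff_C_mul_X_pow, if_pos rfl]
    · intro j hj hji
      have hj := Finset.mem_Icc.1 hj
      rw [Polynomial.coeff_C_mul_X_pow, if_neg (by omega)]
    · intro h
      exact absurd (Finset.mem_Icc.2 ⟨hi, hiM⟩) h
  rw [← hQc, hc]
  rfl

lemma dlcm_ne_zero (n : ℕ) : dlcm n ≠ 0 := by
  unfold dlcm
  rw [Ne, Finset.lcm_eq_zero_iff]
  simp

lemma dvd_dlcm (n j : ℕ) (h1 : 1 ≤ j) (h2 : j ≤ n) : j ∣ dlcm n :=
  Finset.dvd_lcm (f := id) (Finset.mem_Icc.2 ⟨h1, h2⟩)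

lemma F_good (M n k : ℕ) (hk : k ≤ n) (c : ℤ) :
    Good M (fun v => (dlcm n * v) * Ffun c n (dlcm n * v - k)) := by
  obtain ⟨g, hg⟩ := Ffun_expand c n
  have hd' : (dlcm n : ℚ) ≠ 0 := by exact_mod_cast dlcm_ne_zero n
  have hs : ∀ j ∈ Finset.range (n + 1),
      Good M (fun v => (dlcm n * v) * ((g j : ℚ) / (dlcm n * v - k + j))) := by
    intro j hj
    have hj' : j ≤ n := by simpa [Nat.lt_succ_iff] using hj
    by_cases hjk : j = k
    · subst hjk
      refine (Good.const M (g j)).congr ?_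
      filter_upwards [self_mem_nhdsWithin] with v hv
      have hv : v ≠ 0 := hv
      rw [sub_add_cancel, mul_div_cancel₀ _ (mul_ne_zero hd' hv)]
    · have hdv : ((j : ℤ) - k) ∣ (dlcm n : ℤ) := by
        rw [← Int.natAbs_dvd]
        exact Int.natCast_dvd_natCast.2 (dvd_dlcm n (((j : ℤ) - k).natAbs) (by omega) (by omega))
      obtain ⟨e, he⟩ := hdv
      have he' : (dlcm n : ℚ) = ((j : ℚ) - k) * e := by exact_mod_cast he
      have hjk' : (j : ℚ) - k ≠ 0 := sub_ne_zero.2 (by exact_mod_cast hjk)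
      refine ((Good.const M (g j * e)).mul ((Good.id M).mul (Good.geom M e))).congr ?_
      filter_upwards with v
      have : (dlcm n : ℚ) * v - k + j = ((j : ℚ) - k) * (1 + e * v) := by rw [he']; ring
      rw [this, he', div_eq_mul_inv, mul_inv]
      push_cast
      field_simp
  refine (Good.sum _ hs).congr ?_
  filter_upwards [ev_nonpole n k (dlcm n) (dlcm_ne_zero n)] with v hv
  rw [hg _ hv, Finset.mul_sum]

lemma Afun_eq (s δ n : ℕ) (t : ℚ) :
    Afun s δ n t = (4 * t + 2 * n) ^ δ * Ffun 1 n t ^ (s + 2) * Ffun 3 n t ^ (s + 2) := by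
  have h8 : (2 : ℚ) ^ ((6 * s + 12) * n) = (8 ^ n) ^ (s + 2) * (8 ^ n) ^ (s + 2) := by
    have : (8 : ℚ) = 2 ^ 3 := by norm_num
    rw [this, ← pow_mul, ← pow_mul, ← pow_add]
    congr 1; ring
  have hp : poch t (n + 1) ^ (2 * s + 4) = poch t (n + 1) ^ (s + 2) * poch t (n + 1) ^ (s + 2) := by
    rw [← pow_add]; congr 1; ring
  simp only [Afun, Ffun, h8, hp, Int.cast_one, Int.cast_ofNat, div_pow, mul_pow]
  simp only [div_eq_mul_inv, mul_inv]
  ring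

lemma Bfun_eq (s n : ℕ) (t : ℚ) : Bfun s n t = Ffun 3 n t ^ (s + 2) := by
  have h8 : (2 : ℚ) ^ ((3 * s + 6) * n) = (8 ^ n) ^ (s + 2) := by
    have : (8 : ℚ) = 2 ^ 3 := by norm_num
    rw [this, ← pow_mul, ← pow_mul]
    congr 1; ring
  simp only [Bfun, Ffun, h8, Int.cast_ofNat, div_pow, mul_pow]

/-- Integrality of partial-fraction coefficients of `A_n` and `B_n`:
`d_n^{2s+4-i} a_{n,i,k} ∈ ℤ` and `d_n^{s+2-i} b_{n,i,k} ∈ ℤ`. -/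
theorem partial_fraction_coefficients_integrality
    (s δ n : ℕ) (hδ : δ ≤ 1) (hn : 0 < n)
    (a b : ℕ → ℕ → ℚ)
    (ha : ∀ t : ℚ, (∀ k : ℕ, k ≤ n → t + (k : ℚ) ≠ 0) →
      Afun s δ n t = ∑ i ∈ Finset.Icc 1 (2 * s + 4), ∑ k ∈ Finset.range (n + 1),
        a i k / (t + (k : ℚ)) ^ i)
    (hb : ∀ t : ℚ, (∀ k : ℕ, k ≤ n → t + (k : ℚ) ≠ 0) →
      Bfun s n t = ∑ i ∈ Finset.Icc 1 (s + 2), ∑ k ∈ Finset.range (n + 1),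
        b i k / (t + (k : ℚ)) ^ i) :
    (∀ i k : ℕ, 1 ≤ i → i ≤ 2 * s + 4 → k ≤ n →
      ∃ z : ℤ, (dlcm n : ℚ) ^ (2 * s + 4 - i) * a i k = (z : ℚ)) ∧
    (∀ i k : ℕ, 1 ≤ i → i ≤ s + 2 → k ≤ n →
      ∃ z : ℤ, (dlcm n : ℚ) ^ (s + 2 - i) * b i k = (z : ℚ)) := by
  constructor
  · intro i k hi hiM hk
    refine coeff_integral (2 * s + 4) n (dlcm n) k (dlcm_ne_zero n) hk a (Afun s δ n) ha ?_ i hi hiM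
    have hlin : Good (2 * s + 4) (fun v => 4 * ((dlcm n : ℚ) * v - k) + 2 * n) := by
      refine (((Good.const _ (4 * (dlcm n : ℤ))).mul (Good.id _)).add
        (Good.const _ (2 * (n : ℤ) - 4 * k))).congr ?_
      filter_upwards with v
      push_cast
      ring
    refine (((hlin.pow δ).mul ((F_good _ n k hk 1).pow (s + 2))).mul
      ((F_good _ n k hk 3).pow (s + 2))).congr ?_
    filter_upwards with v
    rw [Afun_eq]
    have : 2 * s + 4 = (s + 2) + (s + 2) := by ring
    rw [this, pow_add, mul_pow _ (Ffun 1 n _), mul_pow _ (Ffun 3 n _)]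
    ring
  · intro i k hi hiM hk
    refine coeff_integral (s + 2) n (dlcm n) k (dlcm_ne_zero n) hk b (Bfun s n) hb ?_ i hi hiM
    refine ((F_good _ n k hk 3).pow (s + 2)).congr ?_
    filter_upwards with v
    rw [Bfun_eq, mul_pow]
end

section
/- Fix a nonnegative integer s and δ ∈ {0,1}. Let n be an odd positive integer with n > (2s+4)², and let a_{n,i,k} (1 ≤ i ≤ 2s+4, 0 ≤ k ≤ n) be the unique rational numbers such that A_n(t) = ∑_{i=1}^{2s+4} ∑_{k=0}^{n} a_{n,i,k}/(t+k)^i for every rational t ∉ {0,−1,…,−n}. Then Φ_n^{−(s+2)} · d_n^{2s+4−i} · a_{n,i,k} ∈ ℤ for all 1 ≤ i ≤ 2s+4 and 0 ≤ k ≤ n. -/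
open Filter Finset

open Polynomial in
lemma aux_one (p : ℕ) (D : ℕ) (c d : ℤ) (hd : (p:ℤ)^D ∣ d) :
    (C ((p:ℤ)^(((Finset.Ico 1 (D+1)).filter (fun e => (p:ℤ)^e ∣ c)).card)) : ℤ[X]) ∣
      C (4*d) * X + C c := by
  set T := (Finset.Ico 1 (D+1)).filter (fun e => (p:ℤ)^e ∣ c) with hT
  have h1 : T.card ≤ D := by
    have := Finset.card_filter_le (Finset.Ico 1 (D+1)) (fun e => (p:ℤ)^e ∣ c)
    simpa using this
  have h2 : (p:ℤ)^T.card ∣ c := by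
    rcases T.eq_empty_or_nonempty with h | h
    · simp [h]
    · have hm := T.max'_mem h
      have : T.card ≤ T.max' h := by
        have : T ⊆ Finset.Icc 1 (T.max' h) := by
          intro e he
          rw [Finset.mem_Icc]
          refine ⟨?_, T.le_max' e he⟩
          rw [hT, Finset.mem_filter, Finset.mem_Ico] at he
          exact he.1.1
        simpa using Finset.card_le_card this
      have h3 : (p:ℤ)^(T.max' h) ∣ c := by
        have hm' : ∀ e ∈ T, (p:ℤ)^e ∣ c := by
          intro e he
          rw [hT, Finset.mem_filter] at he
          exact he.2
        exact hm' _ hm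
      exact (pow_dvd_pow _ this).trans h3
  have h3 : (p:ℤ)^T.card ∣ 4 * d := ((pow_dvd_pow _ h1).trans hd).mul_left _
  exact dvd_add ((map_dvd C h3).mul_right _) (map_dvd C h2)

lemma count_lemma (q N : ℕ) (hq : Odd q) (c : ℤ) :
    N / q ≤ ((Finset.range N).filter (fun j : ℕ => (q:ℤ) ∣ 2 * j + c)).card := by
  obtain ⟨m, rfl⟩ := hq
  set q := 2 * m + 1 with hq
  have hq0 : (0:ℤ) < (q:ℤ) := by positivity
  set v : ℕ := (((-c) * (m+1)) % (q:ℤ)).toNat with hv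
  have hvz : (v : ℤ) = ((-c) * (m+1)) % (q:ℤ) := Int.toNat_of_nonneg (Int.emod_nonneg _ hq0.ne')
  have hc := Nat.count_modEq_card N (r := q) (by omega) v
  have : N / q ≤ N.count (· ≡ v [MOD q]) := by rw [hc]; omega
  refine this.trans ?_
  rw [Nat.count_eq_card_filter_range]
  apply Finset.card_le_card
  intro j hj
  rw [Finset.mem_filter] at hj ⊢
  refine ⟨hj.1, ?_⟩
  have h1 : (q:ℤ) ∣ (v:ℤ) - j := (Nat.modEq_iff_dvd).1 hj.2
  have h2 : (q:ℤ) ∣ (-c) * (m+1) - v := by rw [hvz]; exact Int.dvd_self_sub_emod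
  have h3 : 2 * (j:ℤ) + c = (-2) * ((v:ℤ) - j) - 2 * ((-c) * (m+1) - v) + (-c) * q := by
    rw [hq]; push_cast; ring
  rw [h3]
  exact dvd_add (dvd_sub (h1.mul_left _) (h2.mul_left _)) (Dvd.intro_left _ rfl)

lemma dlcm_dvd {n m : ℕ} (h1 : 1 ≤ m) (h2 : m ≤ n) : m ∣ dlcm n :=
  Finset.dvd_lcm (f := id) (Finset.mem_Icc.2 ⟨h1, h2⟩)

lemma dlcm_pos (n : ℕ) : 0 < dlcm n := by
  rw [Nat.pos_iff_ne_zero]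
  unfold dlcm
  rw [Ne, Finset.lcm_eq_zero_iff]
  simp

def condP (n q : ℕ) : Prop :=
  q.Prime ∧ Real.sqrt (10 * n) < (q : ℝ) ∧ 1/2 < Int.fract ((n : ℝ) / q)

lemma Phi_ne (n : ℕ) : Phi n ≠ 0 := by
  unfold Phi
  rw [Finset.prod_ne_zero_iff]
  intro q hq
  rw [Finset.mem_Icc] at hq
  split_ifs <;> omega

lemma Phi_val (n p : ℕ) (hp : p.Prime) :
    padicValNat p (Phi n) ≤ 1 ∧ (padicValNat p (Phi n) ≠ 0 → condP n p ∧ p ≤ n) := by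
  classical
  have := Fact.mk hp
  have : padicValNat p (Phi n) = ∑ q ∈ Finset.Icc 1 n, if (p = q ∧ condP n q) then 1 else 0 := by
    rw [← Nat.factorization_def _ hp]
    unfold Phi
    rw [Nat.factorization_prod]
    · rw [Finsupp.finsetSum_apply]
      apply Finset.sum_congr rfl
      intro q hq
      by_cases h : condP n q
      · have h' := h
        unfold condP at h'
        rw [if_pos h', h.1.factorization]
        simp [Finsupp.single_apply, h, eq_comm]
      · have h' := h
        unfold condP at h'
        rw [if_neg h']
        simp [h]
    · intro q hq
      rw [Finset.mem_Icc] at hq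
      split_ifs <;> omega
  by_cases h : condP n p ∧ p ≤ n
  · refine ⟨?_, fun _ => h⟩
    rw [this]
    calc _ ≤ ∑ q ∈ Finset.Icc 1 n, if p = q then 1 else 0 := by
          apply Finset.sum_le_sum
          intro q _
          split_ifs <;> simp_all
      _ ≤ 1 := by rw [Finset.sum_ite_eq]; split_ifs <;> simp
  · have h0 : padicValNat p (Phi n) = 0 := by
      rw [this]
      apply Finset.sum_eq_zero
      intro q hq
      rw [if_neg]
      rintro ⟨rfl, hc⟩
      exact h ⟨hc, (Finset.mem_Icc.1 hq).2⟩
    rw [h0]; simp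

lemma condP_floor (n p : ℕ) (h : condP n p) : 2 * (n / p) + 1 ≤ (2 * n) / p := by
  obtain ⟨hp, -, h⟩ := h
  have hp0 : (0:ℝ) < p := by exact_mod_cast hp.pos
  rw [Nat.le_div_iff_mul_le hp.pos]
  have hf : ⌊(n:ℝ)/p⌋ = ((n / p : ℕ) : ℤ) := by
    rw [← Nat.floor_div_eq_div (K := ℝ), Int.natCast_floor_eq_floor (by positivity)]
  rw [← Int.self_sub_floor, hf] at h
  have : ((2 * (n / p) + 1 : ℕ):ℝ) * p < 2 * n := by
    have : (2 * ((n / p : ℕ) : ℝ) + 1) < 2 * (n / p : ℝ) := by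
      rw [Int.cast_natCast] at h
      linarith
    have h2 := mul_lt_mul_of_pos_right this hp0
    rw [mul_assoc, div_mul_cancel₀ _ hp0.ne'] at h2
    push_cast at h2 ⊢
    exact h2
  exact_mod_cast this.le

open Polynomial in
lemma W_dvd (n k : ℕ) (hk : k ≤ n) (hn : 1 ≤ n) :
    (C ((Phi n * (k.factorial * (n-k).factorial)^2 : ℕ) : ℤ) : ℤ[X]) ∣
      C (2^(2*n)) * ∏ j ∈ Finset.range (2*n), (C (4*(dlcm n : ℤ)) * X + C (2*(j:ℤ) + (1 - 4*k))) := by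
  set W : ℤ[X] := C (2^(2*n)) *
    ∏ j ∈ Finset.range (2*n), (C (4*(dlcm n : ℤ)) * X + C (2*(j:ℤ) + (1 - 4*k))) with hW
  have hK0 : (k.factorial * (n-k).factorial) ≠ 0 := by positivity
  have hR0 : Phi n * (k.factorial * (n-k).factorial)^2 ≠ 0 := mul_ne_zero (Phi_ne n) (pow_ne_zero _ hK0)
  have key : ∀ p : ℕ, p.Prime →
      (C ((p:ℤ)^(padicValNat p (Phi n * (k.factorial * (n-k).factorial)^2))) : ℤ[X]) ∣ W := by
    intro p hp
    have := Fact.mk hp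
    have hval : padicValNat p (Phi n * (k.factorial * (n-k).factorial)^2) =
        padicValNat p (Phi n) + 2 * (padicValNat p k.factorial + padicValNat p (n-k).factorial) := by
      rw [padicValNat.mul (Phi_ne n) (pow_ne_zero _ hK0), padicValNat.pow,
        padicValNat.mul (by positivity) (by positivity)]
    rcases hp.eq_two_or_odd' with rfl | hodd
    · have h0 : padicValNat 2 (Phi n) = 0 := by
        by_contra h
        obtain ⟨⟨_, h1, _⟩, h2⟩ := (Phi_val n 2 hp).2 h
        rw [Real.sqrt_lt' (by norm_num)] at h1
        have : (1:ℝ) ≤ n := by exact_mod_cast hn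
        norm_num at h1
        linarith
      have e1 := sub_one_mul_padicValNat_factorial (p := 2) k
      have e2 := sub_one_mul_padicValNat_factorial (p := 2) (n-k)
      rw [hval]
      apply Dvd.dvd.mul_right
      apply _root_.map_dvd
      push_cast
      apply pow_dvd_pow
      omega
    · set D := Nat.log p n with hD
      have hpd : (p:ℤ)^D ∣ (dlcm n : ℤ) := by
        have := dlcm_dvd (n := n) (m := p^D) (Nat.one_le_pow _ _ hp.pos)
          (Nat.pow_log_le_self p (by omega))
        exact_mod_cast this
      have h1 : (C ((p:ℤ)^(∑ j ∈ Finset.range (2*n),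
          ((Finset.Ico 1 (D+1)).filter (fun e => (p:ℤ)^e ∣ 2*(j:ℤ) + (1 - 4*k))).card)) : ℤ[X]) ∣ W := by
        rw [← Finset.prod_pow_eq_pow_sum, map_prod]
        apply Dvd.dvd.mul_left
        apply Finset.prod_dvd_prod_of_dvd
        intro j _
        exact aux_one p D _ _ hpd
      refine dvd_trans (map_dvd C (pow_dvd_pow _ ?_)) h1
      have hsw : (∑ j ∈ Finset.range (2*n),
          ((Finset.Ico 1 (D+1)).filter (fun e => (p:ℤ)^e ∣ 2*(j:ℤ) + (1 - 4*k))).card) =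
          ∑ e ∈ Finset.Ico 1 (D+1), ((Finset.range (2*n)).filter
            (fun j : ℕ => ((p^e : ℕ):ℤ) ∣ 2*(j:ℤ) + (1 - 4*k))).card := by
        simp only [Finset.card_filter]
        rw [Finset.sum_comm]
        push_cast
        rfl
      rw [hsw, hval]
      have hb1 : padicValNat p k.factorial = ∑ e ∈ Finset.Ico 1 (D+1), k / p^e :=
        padicValNat_factorial (by have := Nat.log_mono_right (b := p) hk; omega)
      have hb2 : padicValNat p (n-k).factorial = ∑ e ∈ Finset.Ico 1 (D+1), (n-k) / p^e :=
        padicValNat_factorial (by have := Nat.log_mono_right (b := p) (Nat.sub_le n k); omega)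
      have hlow : ∑ e ∈ Finset.Ico 1 (D+1), (2*n) / p^e ≤ ∑ e ∈ Finset.Ico 1 (D+1),
          ((Finset.range (2*n)).filter
            (fun j : ℕ => ((p^e : ℕ):ℤ) ∣ 2*(j:ℤ) + (1 - 4*k))).card :=
        Finset.sum_le_sum fun e _ => count_lemma _ _ hodd.pow _
      refine le_trans ?_ hlow
      have hphi : padicValNat p (Phi n) ≤ ∑ e ∈ Finset.Ico 1 (D+1),
          (if e = 1 then padicValNat p (Phi n) else 0) := by
        by_cases h : padicValNat p (Phi n) = 0
        · omega
        · obtain ⟨_, h2⟩ := (Phi_val n p hp).2 h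
          have : 0 < D := Nat.log_pos hp.one_lt h2
          rw [Finset.sum_ite_eq', if_pos]
          rw [Finset.mem_Ico]; omega
      calc _ ≤ ∑ e ∈ Finset.Ico 1 (D+1), ((if e = 1 then padicValNat p (Phi n) else 0)
              + 2 * (k / p^e + (n-k)/p^e)) := by
            rw [Finset.sum_add_distrib, ← Finset.mul_sum, Finset.sum_add_distrib, hb1, hb2]
            omega
        _ ≤ _ := by
            apply Finset.sum_le_sum
            intro e _
            have a1 : k / p^e + (n-k)/p^e ≤ n / p^e := by
              have := Nat.div_add_div_le_add_div (x := k) (y := (n-k)) (z := p^e)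
              rwa [Nat.add_sub_cancel' hk] at this
            have a2 : n / p^e + n / p^e ≤ (2*n) / p^e := by
              have := Nat.div_add_div_le_add_div (x := n) (y := n) (z := p^e)
              rwa [← two_mul n] at this
            split_ifs with he
            · subst he
              by_cases h : padicValNat p (Phi n) = 0
              · omega
              · have h3 := condP_floor n p ((Phi_val n p hp).2 h).1
                have h4 := (Phi_val n p hp).1
                rw [pow_one] at *
                omega
            · omega
  rw [C_dvd_iff_dvd_coeff]
  intro i
  rw [Int.natCast_dvd]
  · rw [Nat.dvd_iff_prime_pow_dvd_dvd]
    intro p e hp hpe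
    have := Fact.mk hp
    have h5 := (padicValNat_dvd_iff_le hR0).1 hpe
    have h6 := (C_dvd_iff_dvd_coeff _ _).1 (key p hp) i
    have h7 : ((p^e : ℕ) : ℤ) ∣ W.coeff i := by
      push_cast
      exact (pow_dvd_pow _ h5).trans h6
    exact Int.natCast_dvd.1 h7

lemma poch_double (n : ℕ) (t : ℚ) :
    2^(4*n) * (poch (t + 1/4) n * poch (t + 3/4) n) = ∏ j ∈ Finset.range (2*n), (4*t + 2*j + 1) := by
  induction n with
  | zero => simp [poch]
  | succ n ih =>
    rw [show 2*(n+1) = 2*n+1+1 by ring, Finset.prod_range_succ, Finset.prod_range_succ, ← ih]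
    unfold poch
    rw [Finset.prod_range_succ, Finset.prod_range_succ, show 4*(n+1) = 4*n+4 by ring, pow_add]
    push_cast
    ring

lemma U_one (d m : ℤ) (h : m ∣ d) : ∃ U : PowerSeries ℤ,
    (((Polynomial.C d * Polynomial.X + Polynomial.C m : Polynomial ℤ)) : PowerSeries ℤ) * U
      = PowerSeries.C m := by
  obtain ⟨c, rfl⟩ := h
  refine ⟨PowerSeries.invOfUnit (1 + PowerSeries.C c * PowerSeries.X) 1, ?_⟩
  have h1 := PowerSeries.mul_invOfUnit (1 + PowerSeries.C c * PowerSeries.X) (1 : ℤˣ) (by simp)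
  have h2 : (((Polynomial.C (m*c) * Polynomial.X + Polynomial.C m : Polynomial ℤ)) : PowerSeries ℤ)
      = PowerSeries.C m * (1 + PowerSeries.C c * PowerSeries.X) := by
    simp only [Polynomial.coe_add, Polynomial.coe_mul, Polynomial.coe_C, Polynomial.coe_X, map_mul]
    ring
  rw [h2, mul_assoc, h1, mul_one]

lemma prodK (n k : ℕ) (hk : k ≤ n) :
    (∏ l ∈ (Finset.range (n+1)).erase k, ((l:ℤ) - k)) ^ 2
      = ((k.factorial * (n-k).factorial : ℕ) : ℤ)^2 := by
  obtain ⟨m, rfl⟩ := Nat.exists_eq_add_of_le hk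
  have h1 : (Finset.range (k+m+1)).erase k = Finset.range k ∪ Finset.Ico (k+1) (k+m+1) := by
    ext x; simp; omega
  rw [h1, Finset.prod_union (by
    rw [Finset.disjoint_left]; intro x; simp; omega)]
  have h2 : ∏ l ∈ Finset.range k, ((l:ℤ) - k) = (-1)^k * (k.factorial : ℤ) := by
    rw [← Finset.prod_range_reflect, ← Finset.prod_range_add_one_eq_factorial]
    push_cast
    have h0 : ((-1:ℤ))^k = ∏ _j ∈ Finset.range k, (-1:ℤ) := by simp
    rw [h0, ← Finset.prod_mul_distrib]
    apply Finset.prod_congr rfl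
    intro j hj
    rw [Finset.mem_range] at hj
    have : ((k - 1 - j : ℕ) : ℤ) = k - 1 - j := by omega
    rw [this]; ring_nf
  have h3 : ∏ l ∈ Finset.Ico (k+1) (k+m+1), ((l:ℤ) - k) = (m.factorial : ℤ) := by
    rw [Finset.prod_Ico_eq_prod_range, ← Finset.prod_range_add_one_eq_factorial]
    rw [show k+m+1-(k+1) = m by omega]
    push_cast
    apply Finset.prod_congr rfl
    intro j hj
    ring
  rw [h2, h3]
  push_cast
  rw [mul_pow, mul_pow, ← pow_mul, mul_comm k 2, pow_mul, Nat.add_sub_cancel_left]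
  ring

open Polynomial in
lemma poly_identity
    (s δ n : ℕ) (a : ℕ → ℕ → ℚ)
    (ha : ∀ t : ℚ, (∀ k : ℕ, k ≤ n → t + (k : ℚ) ≠ 0) →
      Afun s δ n t = ∑ i ∈ Finset.Icc 1 (2 * s + 4), ∑ k ∈ Finset.range (n + 1),
        a i k / (t + (k : ℚ)) ^ i) (k : ℕ) (hk : k ≤ n) (d : ℕ) (hd : 0 < d) :
    ∃ Q : ℚ[X],
      (((C (4*(d:ℤ)) * X + C (2*(n:ℤ) - 4*k)) ^ δ *
        (C (2^(2*n)) * ∏ j ∈ Finset.range (2*n),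
          (C (4*(d : ℤ)) * X + C (2*(j:ℤ) + (1 - 4*k)))) ^ (s+2) : ℤ[X])).map (Int.castRingHom ℚ)
      = ((∏ l ∈ (Finset.range (n+1)).erase k, (C (d:ℤ) * X + C ((l:ℤ) - k)) : ℤ[X])).map
          (Int.castRingHom ℚ) ^ (2*s+4) *
          (∑ i ∈ Finset.Icc 1 (2*s+4), C ((d:ℚ)^(2*s+4-i) * a i k) * X^(2*s+4-i))
        + X^(2*s+4) * Q := by
  set f : ℕ → ℚ[X] := fun l => C (d:ℚ) * X + C ((l:ℚ) - k) with hf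
  refine ⟨C ((d:ℚ)^(2*s+4)) * ∑ i ∈ Finset.Icc 1 (2*s+4), ∑ l ∈ (Finset.range (n+1)).erase k,
    C (a i l) * (∏ m ∈ (Finset.range (n+1)).erase k, f m)^(2*s+4-i) *
      (∏ m ∈ ((Finset.range (n+1)).erase k).erase l, f m)^i, ?_⟩
  apply Polynomial.eq_of_infinite_eval_eq
  apply Set.infinite_of_injective_forall_mem (f := fun m : ℕ => ((m + n + 1 : ℕ) : ℚ))
  · intro x y hxy
    simp only [Nat.cast_inj] at hxy
    omega
  intro m
  set x : ℚ := ((m + n + 1 : ℕ) : ℚ) with hx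
  set t : ℚ := d * x - k with ht
  have hx1 : (n:ℚ) + 1 ≤ x := by rw [hx]; push_cast; linarith [(Nat.cast_nonneg m : (0:ℚ) ≤ m)]
  have hd1 : (1:ℚ) ≤ d := by exact_mod_cast hd
  have hk1 : (k:ℚ) ≤ n := by exact_mod_cast hk
  have hx0 : 0 < x := by linarith [(Nat.cast_nonneg n : (0:ℚ) ≤ n)]
  have ht0 : 0 < t := by nlinarith
  have htl : ∀ l : ℕ, t + (l:ℚ) ≠ 0 := fun l => by positivity
  have h := ha t (fun l _ => htl l)
  have hfe : ∀ l, (f l).eval x = t + l := by intro l; simp [hf, ht]; ring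
  have htk : t + k = d * x := by rw [ht]; ring
  set E : ℚ := ∏ l ∈ (Finset.range (n+1)).erase k, (t + (l:ℚ)) with hE
  have hE0 : E ≠ 0 := Finset.prod_ne_zero_iff.2 fun l _ => htl l
  have hkm : k ∈ Finset.range (n+1) := by rw [Finset.mem_range]; omega
  have hpo : poch t (n+1) = (d * x) * E := by
    unfold poch
    rw [← Finset.mul_prod_erase _ _ hkm, htk]
  have hdx : (d:ℚ) * x ≠ 0 := by positivity
  have hnum : Afun s δ n t * ((d*x)^(2*s+4) * E^(2*s+4)) =
      (4*t+2*n)^δ * (2^(2*n) * ∏ j ∈ Finset.range (2*n), (4*t + 2*j + 1))^(s+2) := by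
    unfold Afun
    rw [hpo, ← mul_pow, div_mul_cancel₀ _ (pow_ne_zero _ (mul_ne_zero hdx hE0)), ← poch_double]
    rw [show (6*s+12)*n = (2*n + 4*n)*(s+2) by ring, pow_mul, pow_add]
    simp only [mul_pow]
    ring
  simp only [Set.mem_ofPred_eq]
  have hL : (((C (4*(d:ℤ)) * X + C (2*(n:ℤ) - 4*k)) ^ δ *
        (C (2^(2*n)) * ∏ j ∈ Finset.range (2*n),
          (C (4*(d : ℤ)) * X + C (2*(j:ℤ) + (1 - 4*k)))) ^ (s+2) : ℤ[X]).map
            (Int.castRingHom ℚ)).eval x =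
      (4*t+2*n)^δ * (2^(2*n) * ∏ j ∈ Finset.range (2*n), (4*t + 2*j + 1))^(s+2) := by
    simp only [Polynomial.map_mul, Polynomial.map_pow, Polynomial.map_add, Polynomial.map_prod,
      Polynomial.map_C, Polynomial.map_X, eval_mul, eval_pow, eval_add, eval_prod, eval_C, eval_X,
      Int.coe_castRingHom]
    push_cast
    congr 1
    · congr 1; rw [ht]; ring
    · congr 2
      apply Finset.prod_congr rfl
      intro j _
      rw [ht]; ring
  have hD : ((∏ l ∈ (Finset.range (n+1)).erase k, (C (d:ℤ) * X + C ((l:ℤ) - k)) : ℤ[X]).map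
          (Int.castRingHom ℚ)).eval x = E := by
    simp only [Polynomial.map_mul, Polynomial.map_add, Polynomial.map_prod,
      Polynomial.map_C, Polynomial.map_X, eval_mul, eval_add, eval_prod, eval_C, eval_X,
      Int.coe_castRingHom]
    push_cast
    apply Finset.prod_congr rfl
    intro j _
    rw [ht]; ring
  rw [hL, ← hnum, h, eval_add, eval_mul, eval_pow, hD]
  simp only [eval_finsetSum, eval_mul, eval_pow, eval_C, eval_X, eval_prod, hfe]
  rw [Finset.mul_sum, Finset.mul_sum, Finset.mul_sum, ← Finset.sum_add_distrib, Finset.sum_mul]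
  apply Finset.sum_congr rfl
  intro i hi
  rw [Finset.mem_Icc] at hi
  obtain ⟨c, hc⟩ := Nat.exists_eq_add_of_le hi.2
  rw [hc, Nat.add_sub_cancel_left, ← Finset.add_sum_erase _ _ hkm, add_mul, Finset.sum_mul, htk,
    Finset.mul_sum, Finset.mul_sum]
  congr 1
  · rw [pow_add (d*x:ℚ), mul_pow (d:ℚ) x c]
    field_simp
  · apply Finset.sum_congr rfl
    intro l hl
    rw [← hE]
    have hEl : E = (t + l) * ∏ m ∈ ((Finset.range (n+1)).erase k).erase l, (t + (m:ℚ)) := by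
      rw [hE]
      exact (Finset.mul_prod_erase _ (fun l : ℕ => t + (l:ℚ)) hl).symm
    set G := ∏ m ∈ ((Finset.range (n+1)).erase k).erase l, (t + (m:ℚ)) with hG
    have h1 := htl l
    rw [pow_add E, hEl, mul_pow _ _ i, mul_pow (d:ℚ)]
    field_simp

/-- Refined integrality of the partial-fraction coefficients of `A_n`: for odd
`n > (2s+4)²`, `Φ_n^{-(s+2)} d_n^{2s+4-i} a_{n,i,k} ∈ ℤ`. -/
theorem partial_fraction_coefficients_refined_integrality
    (s δ n : ℕ) (hδ : δ ≤ 1) (hodd : Odd n) (hn : (2 * s + 4) ^ 2 < n)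
    (a : ℕ → ℕ → ℚ)
    (ha : ∀ t : ℚ, (∀ k : ℕ, k ≤ n → t + (k : ℚ) ≠ 0) →
      Afun s δ n t = ∑ i ∈ Finset.Icc 1 (2 * s + 4), ∑ k ∈ Finset.range (n + 1),
        a i k / (t + (k : ℚ)) ^ i) :
    ∀ i k : ℕ, 1 ≤ i → i ≤ 2 * s + 4 → k ≤ n →
      ∃ z : ℤ, (dlcm n : ℚ) ^ (2 * s + 4 - i) * a i k = (Phi n : ℚ) ^ (s + 2) * (z : ℚ) := by
  intro i k hi1 hi2 hk
  have hn1 : 1 ≤ n := by omega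
  have hd := dlcm_pos n
  obtain ⟨Q, hQ⟩ := poly_identity s δ n a ha k hk (dlcm n) hd
  obtain ⟨V, hV⟩ := W_dvd n k hk hn1
  rw [hV] at hQ
  have hU : ∀ l : ℕ, ∃ U : PowerSeries ℤ, l ∈ (Finset.range (n+1)).erase k →
      (((Polynomial.C (dlcm n : ℤ) * Polynomial.X + Polynomial.C ((l:ℤ) - k) : Polynomial ℤ)) :
        PowerSeries ℤ) * U = PowerSeries.C ((l:ℤ) - k) := by
    intro l
    by_cases hl : l ∈ (Finset.range (n+1)).erase k
    · rw [Finset.mem_erase, Finset.mem_range] at hl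
      have hdv : ((l:ℤ) - k) ∣ (dlcm n : ℤ) := by
        rw [← Int.natAbs_dvd, Int.natCast_dvd_natCast]
        exact dlcm_dvd (by omega) (by omega)
      obtain ⟨U, hU⟩ := U_one _ _ hdv
      exact ⟨U, fun _ => hU⟩
    · exact ⟨0, fun h => absurd h hl⟩
  choose U hU using hU
  set K : ℤ := ∏ l ∈ (Finset.range (n+1)).erase k, ((l:ℤ) - k) with hK
  have hK2 := prodK n k hk
  rw [← hK] at hK2
  have hK0 : K ≠ 0 := by
    rw [hK, Finset.prod_ne_zero_iff]
    intro l hl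
    rw [Finset.mem_erase] at hl
    omega
  set Dz : Polynomial ℤ := ∏ l ∈ (Finset.range (n+1)).erase k,
    (Polynomial.C (dlcm n : ℤ) * Polynomial.X + Polynomial.C ((l:ℤ) - k)) with hDz
  set UU : PowerSeries ℤ := ∏ l ∈ (Finset.range (n+1)).erase k, U l with hUU
  have hDU : (Dz : PowerSeries ℤ) * UU = PowerSeries.C K := by
    rw [hDz, hUU, ← Polynomial.coeToPowerSeries.ringHom_apply, map_prod, ← Finset.prod_mul_distrib,
      hK, map_prod]
    apply Finset.prod_congr rfl
    intro l hl
    rw [Polynomial.coeToPowerSeries.ringHom_apply]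
    exact hU l hl
  set Lz : Polynomial ℤ := Polynomial.C (4*(dlcm n:ℤ)) * Polynomial.X +
    Polynomial.C (2*(n:ℤ) - 4*k) with hLz
  set S : Polynomial ℚ := ∑ i ∈ Finset.Icc 1 (2*s+4),
    Polynomial.C ((dlcm n:ℚ)^(2*s+4-i) * a i k) * Polynomial.X^(2*s+4-i) with hS
  set φ := Int.castRingHom ℚ with hφ
  have hDU' : PowerSeries.map φ (Dz : PowerSeries ℤ) * PowerSeries.map φ UU
      = PowerSeries.C (K:ℚ) := by
    rw [← map_mul, hDU, PowerSeries.map_C]; simp [hφ]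
  have hQ' := congrArg (fun g : Polynomial ℚ => (g : PowerSeries ℚ)) hQ
  simp only [Polynomial.polynomial_map_coe, Polynomial.coe_add, Polynomial.coe_mul,
    Polynomial.coe_pow, Polynomial.coe_C, Polynomial.coe_X, map_mul, map_pow,
    PowerSeries.map_C] at hQ'
  set Y : PowerSeries ℤ := (Lz : PowerSeries ℤ)^δ * (V : PowerSeries ℤ)^(s+2) * UU^(2*s+4) with hY
  have hfin : PowerSeries.C ((K:ℚ)^(2*s+4) * (Phi n : ℚ)^(s+2)) * PowerSeries.map φ Y =
      PowerSeries.C ((K:ℚ)^(2*s+4)) * (S : PowerSeries ℚ) +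
        PowerSeries.X^(2*s+4) * ((Q : PowerSeries ℚ) * (PowerSeries.map φ UU)^(2*s+4)) := by
    have hc : (K:ℚ)^(2*s+4) * (Phi n : ℚ)^(s+2) =
        (φ ((Phi n * (k.factorial * (n-k).factorial)^2 : ℕ) : ℤ))^(s+2) := by
      have h1 : ((K:ℚ))^2 = (((k.factorial * (n-k).factorial : ℕ) : ℤ) : ℚ)^2 := by
        exact_mod_cast hK2
      rw [show 2*s+4 = 2*(s+2) by ring, pow_mul, h1, hφ]
      push_cast
      rw [← mul_pow]
      congr 1
      simp
      ring
    have h2 := congrArg (fun g => g * (PowerSeries.map φ UU)^(2*s+4)) hQ'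
    simp only [add_mul] at h2
    have h3 : PowerSeries.C ((K:ℚ)^(2*s+4)) =
        (PowerSeries.map φ (Dz : PowerSeries ℤ))^(2*s+4) * (PowerSeries.map φ UU)^(2*s+4) := by
      rw [← mul_pow, hDU', map_pow]
    rw [hc, h3, hY, map_pow]
    simp only [map_mul, map_pow]
    simp only [mul_pow] at h2 ⊢
    linear_combination h2
  have hco := congrArg (PowerSeries.coeff (2*s+4-i)) hfin
  rw [map_add, PowerSeries.coeff_C_mul, PowerSeries.coeff_C_mul, PowerSeries.coeff_X_pow_mul',
    if_neg (by omega), add_zero, PowerSeries.coeff_map, Polynomial.coeff_coe] at hco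
  have hSc : S.coeff (2*s+4-i) = (dlcm n:ℚ)^(2*s+4-i) * a i k := by
    rw [hS, Polynomial.finsetSum_coeff, Finset.sum_eq_single i]
    · rw [Polynomial.coeff_C_mul, Polynomial.coeff_X_pow, if_pos rfl, mul_one]
    · intro j hj hji
      rw [Finset.mem_Icc] at hj
      rw [Polynomial.coeff_C_mul, Polynomial.coeff_X_pow, if_neg (by omega), mul_zero]
    · intro h
      exact absurd (Finset.mem_Icc.2 ⟨hi1, hi2⟩) h
  refine ⟨PowerSeries.coeff (2*s+4-i) Y, ?_⟩
  rw [← hSc]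
  have hKp : (K:ℚ)^(2*s+4) ≠ 0 := pow_ne_zero _ (by exact_mod_cast hK0)
  apply mul_left_cancel₀ hKp
  rw [← hco, mul_assoc]
  rfl
end
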